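/- Let H be a Hamiltonian on [a,b) such that lim_{r→∞} q_H(ir) = cot φ for some φ ∈ (0,π/2) ∪ (π/2,π). Set Q = [[sin φ, −cos φ], [cos φ, sin φ]] and H̃ = Q·H·Qᵀ, and assume that neither diagonal entry of H nor of H̃ vanishes a.e. on any neighbourhood of a. Then, as r → ∞: Im q_{H̃}(ir) is comparable to Im q_H(ir) up to multiplicative constants; Ã(r)/A(r) → 0; and there exist C > 0 and r0 > 0 with L̃(r) ≥ C·L(r) for all r ≥ r0, where Ã, L̃ denote the quantities A, L formed from H̃. -/

import Mathlib

open MeasureTheory Filter Topology Matrix Set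
open scoped ENNReal

noncomputable section

/-- The symplectic matrix `J = [[0,-1],[1,0]]` (real version). -/
def Jmat : Matrix (Fin 2) (Fin 2) ℝ := !![0, -1; 1, 0]

/-- The symplectic matrix `J` (complex version). -/
def JmatC : Matrix (Fin 2) (Fin 2) ℂ := !![0, -1; 1, 0]

/-- `|J| = [[0,1],[1,0]]`. -/
def Jabs : Matrix (Fin 2) (Fin 2) ℝ := !![0, 1; 1, 0]

/-- The entrywise comparison `|U| ⪯ V`. -/
def entryAbsLe (U V : Matrix (Fin 2) (Fin 2) ℝ) : Prop :=
  ∀ i j, |U i j| ≤ V i j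

/-- The filter describing `t → b⁻`, `t` ranging over the reals, `b : EReal`. -/
def toBFilter (b : EReal) : Filter ℝ :=
  Filter.comap (fun t : ℝ => (t : EReal)) (nhdsWithin b (Set.Iio b))

/-- `H` is a Hamiltonian on `[a, b)`. -/
structure IsHamiltonian (a : ℝ) (b : EReal) (H : ℝ → Matrix (Fin 2) (Fin 2) ℝ) : Prop where
  a_lt_b : (a : EReal) < b
  posSemidef : ∀ᵐ (t : ℝ) ∂volume, a ≤ t → (t : EReal) < b → (H t).PosSemidef
  locInt : ∀ (i j : Fin 2) (t : ℝ), a ≤ t → (t : EReal) < b →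
    IntervalIntegrable (fun s => H s i j) volume a t
  zero_null : volume {t : ℝ | a ≤ t ∧ (t : EReal) < b ∧ H t = 0} = 0
  limit_point : (∫⁻ t in {t : ℝ | a ≤ t ∧ (t : EReal) < b},
    ENNReal.ofReal ((H t).trace)) = ⊤

/-- `m1(t) = ∫_a^t h1`. -/
def m1 (a : ℝ) (H : ℝ → Matrix (Fin 2) (Fin 2) ℝ) (t : ℝ) : ℝ := ∫ s in a..t, H s 0 0

/-- `m2(t) = ∫_a^t h2`. -/
def m2 (a : ℝ) (H : ℝ → Matrix (Fin 2) (Fin 2) ℝ) (t : ℝ) : ℝ := ∫ s in a..t, H s 1 1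

/-- `m3(t) = ∫_a^t h3`. -/
def m3 (a : ℝ) (H : ℝ → Matrix (Fin 2) (Fin 2) ℝ) (t : ℝ) : ℝ := ∫ s in a..t, H s 0 1

/-- `M(t) = ∫_a^t H(s) ds`. -/
def Mmat (a : ℝ) (H : ℝ → Matrix (Fin 2) (Fin 2) ℝ) (t : ℝ) : Matrix (Fin 2) (Fin 2) ℝ :=
  !![m1 a H t, m3 a H t; m3 a H t, m2 a H t]

/-- Neither diagonal entry of `H` vanishes a.e. on any neighbourhood of `a`. -/
def DiagNonVanishing (a : ℝ) (b : EReal) (H : ℝ → Matrix (Fin 2) (Fin 2) ℝ) : Prop :=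
  (∀ t : ℝ, a < t → (t : EReal) < b →
    ¬ ∀ᵐ s ∂(volume.restrict (Set.Ioo a t)), H s 0 0 = 0) ∧
  (∀ t : ℝ, a < t → (t : EReal) < b →
    ¬ ∀ᵐ s ∂(volume.restrict (Set.Ioo a t)), H s 1 1 = 0)

/-- `W` is the fundamental solution of `W(t,z)J − J = z ∫_a^t W(s,z)H(s) ds`. -/
def IsFundamentalSolution (a : ℝ) (b : EReal) (H : ℝ → Matrix (Fin 2) (Fin 2) ℝ)
    (W : ℝ → ℂ → Matrix (Fin 2) (Fin 2) ℂ) : Prop :=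
  ∀ (z : ℂ) (t : ℝ), a ≤ t → (t : EReal) < b →
    W t z * JmatC - JmatC =
      z • Matrix.of fun i j =>
        ∫ s in a..t, (W s z * (H s).map (fun x : ℝ => (x : ℂ))) i j

/-- `qH` is the Weyl coefficient of the Hamiltonian `H`. -/
def IsWeylCoefficient (a : ℝ) (b : EReal) (H : ℝ → Matrix (Fin 2) (Fin 2) ℝ)
    (qH : ℂ → ℂ) : Prop :=
  ∃ W : ℝ → ℂ → Matrix (Fin 2) (Fin 2) ℂ,
    IsFundamentalSolution a b H W ∧
    ∀ z : ℂ, z.im ≠ 0 → ∀ ζ : ℂ, 0 ≤ ζ.im →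
      Tendsto (fun t : ℝ =>
          (W t z 0 0 * ζ + W t z 0 1) / (W t z 1 0 * ζ + W t z 1 1))
        (toBFilter b) (nhds (qH z))

/-- `μ` is the spectral measure of `H`, i.e. the measure in the Herglotz
representation of the Weyl coefficient of `H`. -/
def IsSpectralMeasure (a : ℝ) (b : EReal) (H : ℝ → Matrix (Fin 2) (Fin 2) ℝ)
    (μ : Measure ℝ) : Prop :=
  ∃ qH : ℂ → ℂ, IsWeylCoefficient a b H qH ∧
    (∫⁻ t : ℝ, ENNReal.ofReal (1 / (1 + t ^ 2)) ∂μ) < ⊤ ∧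
    ∃ α β : ℝ, 0 ≤ β ∧ ∀ z : ℂ, z.im ≠ 0 →
      qH z = (α : ℂ) + (β : ℂ) * z +
        ∫ t : ℝ, (1 / ((t : ℂ) - z) - (t : ℂ) / (1 + (t : ℂ) ^ 2)) ∂μ

/-- `μ↔(r) = μ((−r, r))`. -/
def muSym (μ : Measure ℝ) (r : ℝ) : ℝ≥0∞ := μ (Set.Ioo (-r) r)

/-- Poisson integral of a measure. -/
def poisson (μ : Measure ℝ) (z : ℂ) : ℝ := ∫ t : ℝ, (1 / ((t : ℂ) - z)).im ∂μ

/-- `g : (0,∞) → (0,∞)` is regularly varying with index `ρ`. -/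
def RegularlyVarying (g : ℝ → ℝ) (ρ : ℝ) : Prop :=
  Measurable g ∧ (∀ r : ℝ, 0 < r → 0 < g r) ∧
  ∀ l : ℝ, 0 < l → Tendsto (fun r : ℝ => g (l * r) / g r) atTop (nhds (l ^ ρ))

/-- `g⋆(r) = ∫_1^r t/g(t) dt`. -/
def gstar (g : ℝ → ℝ) (r : ℝ) : ℝ := ∫ t in (1:ℝ)..r, t / g t

/-- The Kac class `𝓜_g`. -/
def memMg (g : ℝ → ℝ) (μ : Measure ℝ) : Prop :=
  (∫⁻ r in Set.Ici (1:ℝ), ENNReal.ofReal (1 / g r)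
    ∂(Measure.map (fun t : ℝ => |t|) μ)) < ⊤

/-- The class `𝓜̂_g`. -/
def memMhat (g : ℝ → ℝ) (μ : Measure ℝ) : Prop :=
  (∫⁻ r in Set.Ioi (1:ℝ), muSym μ r * ENNReal.ofReal (gstar g r / r ^ 3)) < ⊤

/-- The class `𝓕_g`: `μ↔(r) = O(g(r))`. -/
def memFg (g : ℝ → ℝ) (μ : Measure ℝ) : Prop :=
  ∃ C : ℝ, ∀ᶠ r in atTop, muSym μ r ≤ ENNReal.ofReal (C * g r)

/-- The class `𝓕_g⁰`: `μ↔(r) = o(g(r))`. -/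
def memFg0 (g : ℝ → ℝ) (μ : Measure ℝ) : Prop :=
  ∀ ε : ℝ, 0 < ε → ∀ᶠ r in atTop, muSym μ r ≤ ENNReal.ofReal (ε * g r)

/-- `M⁺(t)`. -/
def MplusMat (a : ℝ) (H : ℝ → Matrix (Fin 2) (Fin 2) ℝ) (t : ℝ) :
    Matrix (Fin 2) (Fin 2) ℝ :=
  !![m1 a H t, Real.sqrt (m1 a H t * m2 a H t);
     Real.sqrt (m1 a H t * m2 a H t), m2 a H t]

/-- `m⁺(t) = 2√(m1(t)m2(t))`. -/
def mplus (a : ℝ) (H : ℝ → Matrix (Fin 2) (Fin 2) ℝ) (t : ℝ) : ℝ :=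
  2 * Real.sqrt (m1 a H t * m2 a H t)

/-- `W` is the sequence of power series coefficients of the fundamental solution:
`W_0 = I`, `W_{n+1}(t) = (∫_a^t W_n H)·(−J)`. -/
def IsCoeffSeq (a : ℝ) (H : ℝ → Matrix (Fin 2) (Fin 2) ℝ)
    (W : ℕ → ℝ → Matrix (Fin 2) (Fin 2) ℝ) : Prop :=
  (∀ t : ℝ, W 0 t = 1) ∧
  ∀ (n : ℕ) (t : ℝ),
    W (n + 1) t = (Matrix.of fun i j => ∫ s in a..t, (W n s * H s) i j) * (-Jmat)

/-- Entrywise integral of a matrix-valued function. -/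
def intMat (f : ℝ → Matrix (Fin 2) (Fin 2) ℝ) (a t : ℝ) : Matrix (Fin 2) (Fin 2) ℝ :=
  Matrix.of fun i j => ∫ s in a..t, f s i j

/-- `α_{n,m}(t) = ∫_a^t W_n H W_m* ds`. -/
def alphaMat (a : ℝ) (H : ℝ → Matrix (Fin 2) (Fin 2) ℝ)
    (W : ℕ → ℝ → Matrix (Fin 2) (Fin 2) ℝ) (n m : ℕ) (t : ℝ) :
    Matrix (Fin 2) (Fin 2) ℝ :=
  intMat (fun s => W n s * H s * (W m s)ᵀ) a t

/-- `β_{n,m}(t) = W_n(t) J W_m(t)*`. -/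
def betaMat (W : ℕ → ℝ → Matrix (Fin 2) (Fin 2) ℝ) (n m : ℕ) (t : ℝ) :
    Matrix (Fin 2) (Fin 2) ℝ :=
  W n t * Jmat * (W m t)ᵀ

/-- `∇(t,z) = ∫_a^t W(s,z) H(s) W(s,z)* ds`. -/
def nablaMat (a : ℝ) (H : ℝ → Matrix (Fin 2) (Fin 2) ℝ)
    (W : ℝ → ℂ → Matrix (Fin 2) (Fin 2) ℂ) (t : ℝ) (z : ℂ) :
    Matrix (Fin 2) (Fin 2) ℂ :=
  Matrix.of fun i j =>
    ∫ s in a..t, (W s z * (H s).map (fun x : ℝ => (x : ℂ)) * (W s z)ᴴ) i j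

/-- Generalised inverse of `f : [a,b) → ℝ`. -/
def genInv (a : ℝ) (b : EReal) (f : ℝ → ℝ) (y : ℝ) : ℝ :=
  sInf {x : ℝ | a ≤ x ∧ (x : EReal) < b ∧ y ≤ f x}

/-- Generalised inverse of `f : [0,b) → [0,∞]`. -/
def genInvE (b : EReal) (f : ℝ → ℝ≥0∞) (y : ℝ) : ℝ :=
  sInf {x : ℝ | 0 ≤ x ∧ (x : EReal) < b ∧ ENNReal.ofReal y ≤ f x}


theorem exists_gronwall_bound {a t₀ : ℝ} {k : ℝ → ℝ} (hk : ∀ s, 0 ≤ k s)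
    (hki : IntervalIntegrable k volume a t₀) :
    ∃ M : ℝ, 0 ≤ M ∧ ∀ (n : ℝ → ℝ) (c t : ℝ), t ∈ Icc a t₀ → (∀ s, 0 ≤ n s) → 0 ≤ c →
      IntervalIntegrable (fun s => n s * k s) volume a t →
      (∀ s ∈ Icc a t, n s ≤ c + ∫ x in a..s, n x * k x) → n t ≤ M * c := by
  obtain ⟨N, hN⟩ := exists_nat_ge (2 * ∫ s in a..t₀, k s)
  refine ⟨2 ^ N, by positivity, fun n c t ht hn hc hnk hle => ?_⟩
  have hnk0 : ∀ s, 0 ≤ n s * k s := fun s => mul_nonneg (hn s) (hk s)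
  have hsub : ∀ {f : ℝ → ℝ} {c d x y : ℝ}, IntervalIntegrable f volume c d →
      c ≤ x → x ≤ y → y ≤ d → IntervalIntegrable f volume x y := by
    intro f c d x y hf h1 h2 h3
    refine hf.mono_set ?_
    rw [uIcc_of_le h2, uIcc_of_le (h1.trans (h2.trans h3))]
    exact Icc_subset_Icc h1 h3
  have key : ∀ (m : ℕ) (s : ℝ), s ∈ Icc a t → 2 * (∫ x in a..s, k x) ≤ m →
      c + ∫ x in a..s, n x * k x ≤ 2 ^ m * c := by
    intro m
    induction m with
    | zero =>
      intro s hs hks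
      have hki' : IntervalIntegrable k volume a s := hsub hki le_rfl hs.1 (hs.2.trans ht.2)
      have h0 : ∫ x in a..s, k x = 0 :=
        le_antisymm (by push_cast at hks; linarith)
          (intervalIntegral.integral_nonneg hs.1 fun x _ => hk x)
      have hae : k =ᵐ[volume.restrict (Ioc a s)] 0 :=
        (intervalIntegral.integral_eq_zero_iff_of_le_of_nonneg_ae hs.1
          (Eventually.of_forall hk) hki').1 h0
      have : ∫ x in a..s, n x * k x = 0 := by
        rw [intervalIntegral.integral_of_le hs.1]
        refine integral_eq_zero_of_ae ?_
        filter_upwards [hae] with x hx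
        simp [hx]
      simp [this]
    | succ m ih =>
      intro s hs hks
      by_cases hm : 2 * (∫ x in a..s, k x) ≤ m
      · refine (ih s hs hm).trans ?_
        rw [pow_succ]
        nlinarith [pow_pos (zero_lt_two (α := ℝ)) m, mul_nonneg (pow_pos (zero_lt_two (α := ℝ)) m).le hc]
      push Not at hm
      have hcont : ContinuousOn (fun x => ∫ y in a..x, k y) (Icc a s) := by
        have := intervalIntegral.continuousOn_primitive_interval'
          (hsub hki le_rfl hs.1 (hs.2.trans ht.2)) (left_mem_uIcc)
        rwa [uIcc_of_le hs.1] at this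
      obtain ⟨s', hs', hks'⟩ := intermediate_value_Icc hs.1 hcont
        (show (m : ℝ) / 2 ∈ Icc _ _ from ⟨by simp; positivity, by linarith⟩)
      have hs't : s' ∈ Icc a t := ⟨hs'.1, hs'.2.trans hs.2⟩
      have h1 := ih s' hs't (by simp only at hks'; rw [hks']; linarith)
      have e1 := intervalIntegral.integral_add_adjacent_intervals
        (hsub hnk le_rfl hs'.1 hs't.2) (hsub hnk hs'.1 hs'.2 hs.2)
      have e2 := intervalIntegral.integral_add_adjacent_intervals
        (hsub hki le_rfl hs'.1 (hs't.2.trans ht.2)) (hsub hki hs'.1 hs'.2 (hs.2.trans ht.2))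
      set R := c + ∫ x in a..s, n x * k x with hR
      have h2 : ∫ x in s'..s, n x * k x ≤ ∫ x in s'..s, R * k x := by
        refine intervalIntegral.integral_mono_on hs'.2 (hsub hnk hs'.1 hs'.2 hs.2)
          ((hsub hki hs'.1 hs'.2 (hs.2.trans ht.2)).const_mul _) fun x hx => ?_
        refine mul_le_mul_of_nonneg_right ?_ (hk x)
        refine (hle x ⟨hs'.1.trans hx.1, hx.2.trans hs.2⟩).trans ?_
        have e3 := intervalIntegral.integral_add_adjacent_intervals
          (hsub hnk le_rfl (hs'.1.trans hx.1) (hx.2.trans hs.2))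
          (hsub hnk (hs'.1.trans hx.1) hx.2 hs.2)
        have := intervalIntegral.integral_nonneg (μ := volume) hx.2 fun y _ => hnk0 y
        linarith
      rw [intervalIntegral.integral_const_mul] at h2
      have hR0 : 0 ≤ R := add_nonneg hc (intervalIntegral.integral_nonneg hs.1 fun y _ => hnk0 y)
      have h3 : ∫ x in s'..s, k x ≤ 1 / 2 := by
        push_cast at hks
        simp only at hks'
        linarith
      have := mul_le_mul_of_nonneg_left h3 hR0
      rw [pow_succ]
      linarith
  refine (hle t ⟨ht.1, le_rfl⟩).trans (key N t ⟨ht.1, le_rfl⟩ (le_trans ?_ hN))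
  have e2 := intervalIntegral.integral_add_adjacent_intervals
        (hsub hki le_rfl ht.1 ht.2) (hsub hki ht.1 ht.2 le_rfl)
  have := intervalIntegral.integral_nonneg (μ := volume) ht.2 fun y _ => hk y
  linarith

theorem IntervalIntegrable.mono_Icc {E : Type*} [NormedAddCommGroup E] {f : ℝ → E} {c d x y : ℝ}
    (hf : IntervalIntegrable f volume c d) (h1 : c ≤ x) (h2 : x ≤ y) (h3 : y ≤ d) :
    IntervalIntegrable f volume x y := by
  refine hf.mono_set ?_
  rw [uIcc_of_le h2, uIcc_of_le (h1.trans (h2.trans h3))]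
  exact Icc_subset_Icc h1 h3

/-- A function given on `[a, t₀]` by `u t = u₀ + c ∫_a^t g` where the integral is understood as `0`
when it diverges is bounded and measurable immediately to the right of each point. -/
theorem exists_right_bounded {a t₀ T : ℝ} {u g : ℝ → ℂ} {u₀ c : ℂ} (haT : a ≤ T) (hT : T < t₀)
    (hu : ∀ t ∈ Icc a t₀, u t = u₀ + c * ∫ s in a..t, g s) :
    ∃ t₁, T < t₁ ∧ t₁ ≤ t₀ ∧ ∃ B : ℝ, AEStronglyMeasurable u (volume.restrict (Ioc T t₁)) ∧
      ∀ t ∈ Ioc T t₁, ‖u t‖ ≤ B := by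
  by_cases hg : ∃ t₁, T < t₁ ∧ t₁ ≤ t₀ ∧ IntervalIntegrable g volume a t₁
  · obtain ⟨t₁, h1, h2, h3⟩ := hg
    have hcont : ContinuousOn u (Icc a t₁) := by
      have := intervalIntegral.continuousOn_primitive_interval' h3 left_mem_uIcc
      rw [uIcc_of_le (haT.trans h1.le)] at this
      exact (continuousOn_const.add (continuousOn_const.mul this)).congr
        fun t ht => hu t ⟨ht.1, ht.2.trans h2⟩
    obtain ⟨B, hB⟩ := isCompact_Icc.exists_bound_of_continuousOn hcont
    have hsub : Ioc T t₁ ⊆ Icc a t₁ := fun x hx => ⟨haT.trans hx.1.le, hx.2⟩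
    exact ⟨t₁, h1, h2, B, (hcont.mono hsub).aestronglyMeasurable measurableSet_Ioc,
      fun t ht => hB t (hsub ht)⟩
  · push Not at hg
    have hc : ∀ t ∈ Ioc T t₀, u t = u₀ := fun t ht => by
      rw [hu t ⟨haT.trans ht.1.le, ht.2⟩,
        intervalIntegral.integral_undef (hg t ht.1 ht.2), mul_zero, add_zero]
    refine ⟨t₀, hT, le_rfl, ‖u₀‖, ?_, fun t ht => by rw [hc t ht]⟩
    exact (aestronglyMeasurable_const (b := u₀)).congr
      ((ae_restrict_of_forall_mem measurableSet_Ioc fun t ht => (hc t ht).symm))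

/-- Solutions of the integrated canonical system are continuous and
bounded in terms of their initial values, even if the integrals are a priori
only understood in the sense that divergent integrals vanish. -/
theorem continuousOn_of_integral_equation {a t₀ : ℝ} (hat : a ≤ t₀) {h₁ h₂ h₃ h₄ : ℝ → ℝ}
    (i₁ : IntervalIntegrable h₁ volume a t₀) (i₂ : IntervalIntegrable h₂ volume a t₀)
    (i₃ : IntervalIntegrable h₃ volume a t₀) (i₄ : IntervalIntegrable h₄ volume a t₀)
    {u v : ℝ → ℂ} {u₀ v₀ c d : ℂ}
    (hu : ∀ t ∈ Icc a t₀, u t = u₀ + c * ∫ s in a..t, (u s * (h₁ s : ℂ) + v s * (h₂ s : ℂ)))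
    (hv : ∀ t ∈ Icc a t₀, v t = v₀ + d * ∫ s in a..t, (u s * (h₃ s : ℂ) + v s * (h₄ s : ℂ))) :
    ContinuousOn u (Icc a t₀) ∧ ContinuousOn v (Icc a t₀) ∧
      ∃ M : ℝ, ∀ t ∈ Icc a t₀, ‖u t‖ + ‖v t‖ ≤ M * (‖u₀‖ + ‖v₀‖) := by
  set f : ℝ → ℂ := fun s => u s * (h₁ s : ℂ) + v s * (h₂ s : ℂ) with hf
  set g : ℝ → ℂ := fun s => u s * (h₃ s : ℂ) + v s * (h₄ s : ℂ) with hg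
  let E : Set ℝ := {t | t ∈ Icc a t₀ ∧ IntervalIntegrable f volume a t ∧
    IntervalIntegrable g volume a t}
  have hcont : ∀ t ∈ E, ContinuousOn u (Icc a t) ∧ ContinuousOn v (Icc a t) := by
    rintro t ⟨ht, htf, htg⟩
    have hF := intervalIntegral.continuousOn_primitive_interval' htf left_mem_uIcc
    have hG := intervalIntegral.continuousOn_primitive_interval' htg left_mem_uIcc
    rw [uIcc_of_le ht.1] at hF hG
    exact ⟨(continuousOn_const.add (continuousOn_const.mul hF)).congr
        fun s hs => hu s ⟨hs.1, hs.2.trans ht.2⟩,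
      (continuousOn_const.add (continuousOn_const.mul hG)).congr
        fun s hs => hv s ⟨hs.1, hs.2.trans ht.2⟩⟩
  have haE : a ∈ E := ⟨⟨le_rfl, hat⟩, by simp, by simp⟩
  have hEbdd : BddAbove E := ⟨t₀, fun t ht => ht.1.2⟩
  have hEdown : ∀ t ∈ E, ∀ s ∈ Icc a t, s ∈ E := fun t ht s hs =>
    ⟨⟨hs.1, hs.2.trans ht.1.2⟩, ht.2.1.mono_Icc le_rfl hs.1 hs.2,
      ht.2.2.mono_Icc le_rfl hs.1 hs.2⟩
  -- uniform bound on `E`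
  let k : ℝ → ℝ := fun s => ‖c‖ * (|h₁ s| + |h₂ s|) + ‖d‖ * (|h₃ s| + |h₄ s|)
  have hki : IntervalIntegrable k volume a t₀ :=
    ((i₁.abs.add i₂.abs).const_mul _).add ((i₃.abs.add i₄.abs).const_mul _)
  obtain ⟨M, hM0, hM⟩ := exists_gronwall_bound (fun s => by positivity) hki
  have hbd : ∀ t ∈ E, ‖u t‖ + ‖v t‖ ≤ M * (‖u₀‖ + ‖v₀‖) := by
    intro t ht
    obtain ⟨cu, cv⟩ := hcont t ht
    have hI : IntervalIntegrable (fun s => (‖u s‖ + ‖v s‖) * k s) volume a t := by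
      refine (hki.mono_Icc le_rfl ht.1.1 ht.1.2).continuousOn_mul ?_
      rw [uIcc_of_le ht.1.1]
      exact cu.norm.add cv.norm
    refine hM (fun s => ‖u s‖ + ‖v s‖) _ t ht.1 (fun s => by positivity) (by positivity) hI ?_
    intro s hs
    have hsE := hEdown t ht s hs
    have hle : ‖∫ x in a..s, f x‖ ≤ ∫ x in a..s, ‖f x‖ :=
      intervalIntegral.norm_integral_le_integral_norm hs.1
    have hle' : ‖∫ x in a..s, g x‖ ≤ ∫ x in a..s, ‖g x‖ :=
      intervalIntegral.norm_integral_le_integral_norm hs.1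
    have h1 : ‖u s‖ ≤ ‖u₀‖ + ‖c‖ * ∫ x in a..s, ‖f x‖ := by
      rw [hu s hsE.1]
      refine (norm_add_le _ _).trans ?_
      rw [norm_mul]
      gcongr
    have h2 : ‖v s‖ ≤ ‖v₀‖ + ‖d‖ * ∫ x in a..s, ‖g x‖ := by
      rw [hv s hsE.1]
      refine (norm_add_le _ _).trans ?_
      rw [norm_mul]
      gcongr
    have h3 : ‖c‖ * (∫ x in a..s, ‖f x‖) + ‖d‖ * (∫ x in a..s, ‖g x‖)
        ≤ ∫ x in a..s, (‖u x‖ + ‖v x‖) * k x := by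
      rw [← intervalIntegral.integral_const_mul, ← intervalIntegral.integral_const_mul,
        ← intervalIntegral.integral_add (hsE.2.1.norm.const_mul _) (hsE.2.2.norm.const_mul _)]
      refine intervalIntegral.integral_mono_on hs.1
        ((hsE.2.1.norm.const_mul _).add (hsE.2.2.norm.const_mul _))
        (hI.mono_Icc le_rfl hs.1 hs.2) fun x _ => ?_
      have e1 : ‖f x‖ ≤ (‖u x‖ + ‖v x‖) * (|h₁ x| + |h₂ x|) := by
        refine (norm_add_le _ _).trans ?_
        rw [norm_mul, norm_mul, Complex.norm_real, Complex.norm_real, Real.norm_eq_abs,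
          Real.norm_eq_abs]
        nlinarith [norm_nonneg (u x), norm_nonneg (v x), abs_nonneg (h₁ x), abs_nonneg (h₂ x),
          mul_nonneg (norm_nonneg (u x)) (abs_nonneg (h₂ x)),
          mul_nonneg (norm_nonneg (v x)) (abs_nonneg (h₁ x))]
      have e2 : ‖g x‖ ≤ (‖u x‖ + ‖v x‖) * (|h₃ x| + |h₄ x|) := by
        refine (norm_add_le _ _).trans ?_
        rw [norm_mul, norm_mul, Complex.norm_real, Complex.norm_real, Real.norm_eq_abs,
          Real.norm_eq_abs]
        nlinarith [norm_nonneg (u x), norm_nonneg (v x), abs_nonneg (h₃ x), abs_nonneg (h₄ x),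
          mul_nonneg (norm_nonneg (u x)) (abs_nonneg (h₄ x)),
          mul_nonneg (norm_nonneg (v x)) (abs_nonneg (h₃ x))]
      have e1' := mul_le_mul_of_nonneg_left e1 (norm_nonneg c)
      have e2' := mul_le_mul_of_nonneg_left e2 (norm_nonneg d)
      simp only [k]
      linarith
    linarith
  suffices t₀ ∈ E from ⟨(hcont t₀ this).1, (hcont t₀ this).2, M,
    fun t ht => hbd t (hEdown t₀ this t ht)⟩
  -- the supremum belongs to `E`
  set T := sSup E with hT
  have haT : a ≤ T := le_csSup hEbdd haE
  have hTt : T ≤ t₀ := csSup_le ⟨a, haE⟩ fun t ht => ht.1.2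
  have hlt : ∀ t, a ≤ t → t < T → t ∈ E := fun t hat ht => by
    obtain ⟨s, hs, hts⟩ := exists_lt_of_lt_csSup ⟨a, haE⟩ ht
    exact hEdown s hs t ⟨hat, hts.le⟩
  have hinteg : ∀ {x y : ℝ} {B₁ B₂ : ℝ}, a ≤ x → x ≤ y → y ≤ t₀ →
      AEStronglyMeasurable u (volume.restrict (Ioc x y)) →
      AEStronglyMeasurable v (volume.restrict (Ioc x y)) →
      (∀ᵐ t ∂volume.restrict (Ioc x y), ‖u t‖ ≤ B₁) →
      (∀ᵐ t ∂volume.restrict (Ioc x y), ‖v t‖ ≤ B₂) →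
      IntervalIntegrable f volume x y ∧ IntervalIntegrable g volume x y := by
    intro x y B₁ B₂ hax hxy hyt mu mv bu bv
    have hh : ∀ {h : ℝ → ℝ}, IntervalIntegrable h volume a t₀ →
        Integrable (fun x => (h x : ℂ)) (volume.restrict (Ioc x y)) := fun hi =>
      ((intervalIntegrable_iff_integrableOn_Ioc_of_le hxy).1 (hi.mono_Icc hax hxy hyt)).ofReal
    rw [intervalIntegrable_iff_integrableOn_Ioc_of_le hxy,
      intervalIntegrable_iff_integrableOn_Ioc_of_le hxy]
    exact ⟨(Integrable.bdd_mul (hh i₁) mu bu).add (Integrable.bdd_mul (hh i₂) mv bv),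
      (Integrable.bdd_mul (hh i₃) mu bu).add (Integrable.bdd_mul (hh i₄) mv bv)⟩
  have hTE : T ∈ E := by
    have hcT : ContinuousOn u (Ioo a T) ∧ ContinuousOn v (Ioo a T) := by
      constructor <;>
      · intro t ht
        obtain ⟨s, hts, hsT⟩ := exists_between ht.2
        have := hcont s (hlt s (ht.1.le.trans hts.le) hsT)
        first
        | exact (this.1.continuousAt (Icc_mem_nhds ht.1 hts)).continuousWithinAt
        | exact (this.2.continuousAt (Icc_mem_nhds ht.1 hts)).continuousWithinAt
    have hr : volume.restrict (Ioc a T) = volume.restrict (Ioo a T) :=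
      Measure.restrict_congr_set Ioo_ae_eq_Ioc.symm
    have hb : ∀ᵐ t ∂volume.restrict (Ioc a T), ‖u t‖ + ‖v t‖ ≤ M * (‖u₀‖ + ‖v₀‖) := by
      rw [hr]
      exact ae_restrict_of_forall_mem measurableSet_Ioo fun t ht => hbd t (hlt t ht.1.le ht.2)
    have := hinteg (B₁ := M * (‖u₀‖ + ‖v₀‖)) (B₂ := M * (‖u₀‖ + ‖v₀‖)) le_rfl haT hTt
      (hr ▸ hcT.1.aestronglyMeasurable measurableSet_Ioo)
      (hr ▸ hcT.2.aestronglyMeasurable measurableSet_Ioo)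
      (hb.mono fun t ht => by linarith [norm_nonneg (v t)])
      (hb.mono fun t ht => by linarith [norm_nonneg (u t)])
    exact ⟨⟨haT, hTt⟩, this⟩
  rcases hTt.eq_or_lt with h | h
  · rwa [h] at hTE
  exfalso
  obtain ⟨t₁, h1, h1', B₁, mu, bu⟩ := exists_right_bounded haT h hu
  obtain ⟨t₂, h2, h2', B₂, mv, bv⟩ := exists_right_bounded haT h hv
  have hsub₁ : Ioc T (min t₁ t₂) ⊆ Ioc T t₁ := Ioc_subset_Ioc_right (min_le_left _ _)
  have hsub₂ : Ioc T (min t₁ t₂) ⊆ Ioc T t₂ := Ioc_subset_Ioc_right (min_le_right _ _)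
  have hTm : T < min t₁ t₂ := lt_min h1 h2
  have hmt : min t₁ t₂ ≤ t₀ := (min_le_left _ _).trans h1'
  have := hinteg haT hTm.le hmt (mu.mono_set hsub₁) (mv.mono_set hsub₂)
    (ae_restrict_of_forall_mem measurableSet_Ioc fun t ht => bu t (hsub₁ ht))
    (ae_restrict_of_forall_mem measurableSet_Ioc fun t ht => bv t (hsub₂ ht))
  have hmE : min t₁ t₂ ∈ E :=
    ⟨⟨haT.trans hTm.le, hmt⟩, hTE.2.1.trans this.1, hTE.2.2.trans this.2⟩
  exact absurd (le_csSup hEbdd hmE) (not_le.2 hTm)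

/-- The value at `(x, y)` of the Hermitian form with matrix `[[h₁, h₃], [h₃, h₂]]`. -/
def quadForm (h₁ h₂ h₃ : ℝ) (x y : ℂ) : ℝ :=
  h₁ * Complex.normSq x + 2 * h₃ * (x.re * y.re + x.im * y.im) + h₂ * Complex.normSq y

theorem real_quadForm_nonneg {h₁ h₂ h₃ : ℝ} (p₁ : 0 ≤ h₁) (p₂ : 0 ≤ h₂) (p₃ : h₃ ^ 2 ≤ h₁ * h₂)
    (x y : ℝ) : 0 ≤ h₁ * x ^ 2 + 2 * h₃ * (x * y) + h₂ * y ^ 2 := by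
  rcases p₁.eq_or_lt with h | h
  · subst h
    have : h₃ = 0 := by nlinarith
    subst this
    nlinarith [mul_nonneg p₂ (sq_nonneg y)]
  · have : 0 ≤ h₁ * (h₁ * x ^ 2 + 2 * h₃ * (x * y) + h₂ * y ^ 2) := by
      nlinarith [sq_nonneg (h₁ * x + h₃ * y), mul_nonneg (sub_nonneg.2 p₃) (sq_nonneg y)]
    exact nonneg_of_mul_nonneg_right this h

theorem quadForm_nonneg {h₁ h₂ h₃ : ℝ} (p₁ : 0 ≤ h₁) (p₂ : 0 ≤ h₂) (p₃ : h₃ ^ 2 ≤ h₁ * h₂)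
    (x y : ℂ) : 0 ≤ quadForm h₁ h₂ h₃ x y := by
  have := add_nonneg (real_quadForm_nonneg p₁ p₂ p₃ x.re y.re)
    (real_quadForm_nonneg p₁ p₂ p₃ x.im y.im)
  rw [quadForm, Complex.normSq_apply, Complex.normSq_apply]
  nlinarith

theorem quadForm_sub_le {h₁ h₂ h₃ : ℝ} (p₁ : 0 ≤ h₁) (p₂ : 0 ≤ h₂) (p₃ : h₃ ^ 2 ≤ h₁ * h₂)
    (x y x' y' : ℂ) :
    quadForm h₁ h₂ h₃ (x - x') (y - y') ≤
      2 * quadForm h₁ h₂ h₃ x y + 2 * quadForm h₁ h₂ h₃ x' y' := by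
  have := quadForm_nonneg p₁ p₂ p₃ (x + x') (y + y')
  simp only [quadForm, Complex.normSq_apply, Complex.add_re, Complex.add_im, Complex.sub_re,
    Complex.sub_im] at this ⊢
  linarith

theorem quadForm_le_diag {h₁ h₂ h₃ : ℝ} (p₁ : 0 ≤ h₁) (p₂ : 0 ≤ h₂) (p₃ : h₃ ^ 2 ≤ h₁ * h₂)
    (x y : ℂ) :
    quadForm h₁ h₂ h₃ x y ≤ 2 * (h₁ * Complex.normSq x + h₂ * Complex.normSq y) := by
  have := quadForm_nonneg p₁ p₂ p₃ x (-y)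
  simp only [quadForm, Complex.normSq_apply, Complex.neg_re, Complex.neg_im] at this ⊢
  linarith

theorem normSq_mul_add_mul_le {h₁ h₂ h₃ : ℝ} (p₃ : h₃ ^ 2 ≤ h₁ * h₂) (x y : ℂ) :
    ‖x * (h₃ : ℂ) + y * (h₂ : ℂ)‖ ^ 2 ≤ quadForm h₁ h₂ h₃ x y * h₂ := by
  have := mul_nonneg (sub_nonneg.2 p₃) (Complex.normSq_nonneg x)
  rw [Complex.sq_norm]
  simp only [quadForm, Complex.normSq_apply, Complex.add_re, Complex.add_im, Complex.mul_re,
    Complex.mul_im, Complex.ofReal_re, Complex.ofReal_im] at this ⊢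
  nlinarith

theorem quadForm_swap (h₁ h₂ h₃ : ℝ) (x y : ℂ) :
    quadForm h₁ h₂ h₃ x y = quadForm h₂ h₁ h₃ y x := by
  simp only [quadForm]; ring

/-- A form of the Cauchy-Schwarz inequality for integrals. -/
theorem norm_integral_sq_le {a t : ℝ} (hat : a ≤ t) {f : ℝ → ℂ} {p q : ℝ → ℝ}
    (hf : IntervalIntegrable f volume a t)
    (hp : IntervalIntegrable p volume a t) (hq : IntervalIntegrable q volume a t)
    (h : ∀ᵐ s ∂volume.restrict (Ioc a t), 0 ≤ p s ∧ 0 ≤ q s ∧ ‖f s‖ ^ 2 ≤ p s * q s) :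
    ‖∫ s in a..t, f s‖ ^ 2 ≤ (∫ s in a..t, p s) * ∫ s in a..t, q s := by
  have key : ∀ l : ℝ, 0 ≤ (∫ s in a..t, p s) * (l * l) + (-2 * ∫ s in a..t, ‖f s‖) * l
      + ∫ s in a..t, q s := by
    intro l
    have hi : 0 ≤ ∫ s in a..t, (l ^ 2 * p s - 2 * l * ‖f s‖ + q s) := by
      refine intervalIntegral.integral_nonneg_of_ae_restrict hat ?_
      rw [Measure.restrict_congr_set Ioc_ae_eq_Icc.symm]
      filter_upwards [h] with s ⟨h1, h2, h3⟩
      show 0 ≤ _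
      rcases h1.eq_or_lt with h0 | h0
      · rw [← h0, zero_mul] at h3
        have : ‖f s‖ = 0 := by nlinarith [norm_nonneg (f s)]
        rw [this, ← h0]
        linarith
      · refine nonneg_of_mul_nonneg_right ?_ h0
        nlinarith [sq_nonneg (l * p s - ‖f s‖)]
    rw [intervalIntegral.integral_add ((hp.const_mul _).sub (hf.norm.const_mul _)) hq,
      intervalIntegral.integral_sub (hp.const_mul _) (hf.norm.const_mul _),
      intervalIntegral.integral_const_mul, intervalIntegral.integral_const_mul] at hi
    linarith
  have hd := discrim_le_zero key
  have hn : ‖∫ s in a..t, f s‖ ^ 2 ≤ (∫ s in a..t, ‖f s‖) ^ 2 :=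
    pow_le_pow_left₀ (norm_nonneg _) (intervalIntegral.norm_integral_le_integral_norm hat) 2
  rw [discrim] at hd
  nlinarith

/-- The real symmetric matrix function `[[h₁, h₃], [h₃, h₂]]` is integrable on `[a, t₀]` and
positive semidefinite almost everywhere. -/
structure IsPosOn (a t₀ : ℝ) (h₁ h₂ h₃ : ℝ → ℝ) : Prop where
  le : a ≤ t₀
  i₁ : IntervalIntegrable h₁ volume a t₀
  i₂ : IntervalIntegrable h₂ volume a t₀
  i₃ : IntervalIntegrable h₃ volume a t₀
  pos : ∀ᵐ s ∂volume.restrict (Ioc a t₀), 0 ≤ h₁ s ∧ 0 ≤ h₂ s ∧ h₃ s ^ 2 ≤ h₁ s * h₂ s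

/-- `(u, v)` is a row solution on `[a, t₀]` of the canonical system with spectral parameter `ir`. -/
structure IsRowSolution (a t₀ : ℝ) (h₁ h₂ h₃ : ℝ → ℝ) (r : ℝ) (u v : ℝ → ℂ) : Prop where
  cu : ContinuousOn u (Icc a t₀)
  cv : ContinuousOn v (Icc a t₀)
  eu : ∀ t ∈ Icc a t₀,
    u t = u a - (r * Complex.I) * ∫ s in a..t, (u s * (h₃ s : ℂ) + v s * (h₂ s : ℂ))
  ev : ∀ t ∈ Icc a t₀,
    v t = v a + (r * Complex.I) * ∫ s in a..t, (u s * (h₁ s : ℂ) + v s * (h₃ s : ℂ))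

section RowSolution

variable {a t₀ r : ℝ} {h₁ h₂ h₃ : ℝ → ℝ} {u v : ℝ → ℂ}

theorem IsPosOn.mono (hp : IsPosOn a t₀ h₁ h₂ h₃) {t : ℝ} (ht : t ∈ Icc a t₀) :
    IsPosOn a t h₁ h₂ h₃ where
  le := ht.1
  i₁ := hp.i₁.mono_Icc le_rfl ht.1 ht.2
  i₂ := hp.i₂.mono_Icc le_rfl ht.1 ht.2
  i₃ := hp.i₃.mono_Icc le_rfl ht.1 ht.2
  pos := ae_restrict_of_ae_restrict_of_subset (Ioc_subset_Ioc_right ht.2) hp.pos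

theorem IsRowSolution.mono (hs : IsRowSolution a t₀ h₁ h₂ h₃ r u v) {t : ℝ} (ht : t ≤ t₀) :
    IsRowSolution a t h₁ h₂ h₃ r u v where
  cu := hs.cu.mono (Icc_subset_Icc_right ht)
  cv := hs.cv.mono (Icc_subset_Icc_right ht)
  eu s hs' := hs.eu s ⟨hs'.1, hs'.2.trans ht⟩
  ev s hs' := hs.ev s ⟨hs'.1, hs'.2.trans ht⟩

theorem intervalIntegrable_mul_ofReal {h : ℝ → ℝ} (hat : a ≤ t₀)
    (hu : ContinuousOn u (Icc a t₀)) (hh : IntervalIntegrable h volume a t₀) :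
    IntervalIntegrable (fun s => u s * (h s : ℂ)) volume a t₀ := by
  refine IntervalIntegrable.continuousOn_mul (f := fun s => (h s : ℂ)) ⟨hh.1.ofReal, hh.2.ofReal⟩ ?_
  rwa [uIcc_of_le hat]

theorem IsRowSolution.intervalIntegrable_quadForm (hp : IsPosOn a t₀ h₁ h₂ h₃)
    (hs : IsRowSolution a t₀ h₁ h₂ h₃ r u v) :
    IntervalIntegrable (fun s => quadForm (h₁ s) (h₂ s) (h₃ s) (u s) (v s)) volume a t₀ := by
  have cu := hs.cu
  have cv := hs.cv
  rw [← uIcc_of_le hp.le] at cu cv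
  have cru := Complex.continuous_re.comp_continuousOn cu
  have ciu := Complex.continuous_im.comp_continuousOn cu
  have crv := Complex.continuous_re.comp_continuousOn cv
  have civ := Complex.continuous_im.comp_continuousOn cv
  exact ((hp.i₁.mul_continuousOn (Complex.continuous_normSq.comp_continuousOn cu)).add
    ((hp.i₃.const_mul 2).mul_continuousOn ((cru.mul crv).add (ciu.mul civ)))).add
    (hp.i₂.mul_continuousOn (Complex.continuous_normSq.comp_continuousOn cv))

theorem IsRowSolution.linear (hp : IsPosOn a t₀ h₁ h₂ h₃) {u' v' : ℝ → ℂ}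
    (hs : IsRowSolution a t₀ h₁ h₂ h₃ r u v) (hs' : IsRowSolution a t₀ h₁ h₂ h₃ r u' v') (c : ℂ) :
    IsRowSolution a t₀ h₁ h₂ h₃ r (fun t => u t - c * u' t) (fun t => v t - c * v' t) where
  cu := hs.cu.sub (continuousOn_const.mul hs'.cu)
  cv := hs.cv.sub (continuousOn_const.mul hs'.cv)
  eu t ht := by
    have hpt := hp.mono ht
    have hst := hs.mono ht.2
    have hst' := hs'.mono ht.2
    have e : ∀ s, (u s - c * u' s) * (h₃ s : ℂ) + (v s - c * v' s) * (h₂ s : ℂ) =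
      (u s * (h₃ s : ℂ) + v s * (h₂ s : ℂ)) - c * (u' s * (h₃ s : ℂ) + v' s * (h₂ s : ℂ)) :=
      fun s => by ring
    simp only [e]
    rw [intervalIntegral.integral_sub, intervalIntegral.integral_const_mul, hs.eu t ht,
      hs'.eu t ht]
    · ring
    · exact (intervalIntegrable_mul_ofReal ht.1 hst.cu hpt.i₃).add
        (intervalIntegrable_mul_ofReal ht.1 hst.cv hpt.i₂)
    · exact ((intervalIntegrable_mul_ofReal ht.1 hst'.cu hpt.i₃).add
        (intervalIntegrable_mul_ofReal ht.1 hst'.cv hpt.i₂)).const_mul c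
  ev t ht := by
    have hpt := hp.mono ht
    have hst := hs.mono ht.2
    have hst' := hs'.mono ht.2
    have e : ∀ s, (u s - c * u' s) * (h₁ s : ℂ) + (v s - c * v' s) * (h₃ s : ℂ) =
      (u s * (h₁ s : ℂ) + v s * (h₃ s : ℂ)) - c * (u' s * (h₁ s : ℂ) + v' s * (h₃ s : ℂ)) :=
      fun s => by ring
    simp only [e]
    rw [intervalIntegral.integral_sub, intervalIntegral.integral_const_mul, hs.ev t ht,
      hs'.ev t ht]
    · ring
    · exact (intervalIntegrable_mul_ofReal ht.1 hst.cu hpt.i₁).add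
        (intervalIntegrable_mul_ofReal ht.1 hst.cv hpt.i₃)
    · exact ((intervalIntegrable_mul_ofReal ht.1 hst'.cu hpt.i₁).add
        (intervalIntegrable_mul_ofReal ht.1 hst'.cv hpt.i₃)).const_mul c

/-- The product rule for indefinite integrals. -/
theorem mul_sub_mul_eq_integral (hat : a ≤ t₀) {x y p q : ℝ → ℝ}
    (hp : IntervalIntegrable p volume a t₀) (hq : IntervalIntegrable q volume a t₀)
    (hx : ∀ t ∈ Icc a t₀, x t = x a + ∫ s in a..t, p s)
    (hy : ∀ t ∈ Icc a t₀, y t = y a + ∫ s in a..t, q s) :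
    IntervalIntegrable (fun s => p s * y s + x s * q s) volume a t₀ ∧
    x t₀ * y t₀ - x a * y a = ∫ s in a..t₀, (p s * y s + x s * q s) := by
  have hax : ∀ {z p : ℝ → ℝ}, IntervalIntegrable p volume a t₀ →
      (∀ t ∈ Icc a t₀, z t = z a + ∫ s in a..t, p s) →
      AbsolutelyContinuousOnInterval (fun t => z a + ∫ s in a..t, p s) a t₀ ∧
      ContinuousOn z (Icc a t₀) ∧
      ∀ᵐ t, t ∈ uIcc a t₀ → HasDerivAt (fun t => z a + ∫ s in a..t, p s) (p t) t := by
    intro z p hp hz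
    have hac : AbsolutelyContinuousOnInterval (fun t => z a + ∫ s in a..t, p s) a t₀ :=
      (LipschitzOnWith.absolutelyContinuousOnInterval
        ((LipschitzWith.const (z a)).lipschitzOnWith)).add
        (hp.absolutelyContinuousOnInterval_intervalIntegral left_mem_uIcc)
    refine ⟨hac, ?_, ?_⟩
    · have := hac.continuousOn
      rw [uIcc_of_le hat] at this
      exact this.congr hz
    · filter_upwards [hp.ae_hasDerivAt_integral] with t ht htm
      exact (ht htm a left_mem_uIcc).const_add _
  obtain ⟨ax, cx, dx⟩ := hax hp hx
  obtain ⟨ay, cy, dy⟩ := hax hq hy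
  refine ⟨?_, ?_⟩
  · rw [← uIcc_of_le hat] at cx cy
    exact (hp.mul_continuousOn cy).add (hq.continuousOn_mul cx)
  · have := ax.integral_deriv_mul_eq_sub ay
    rw [← hx t₀ ⟨hat, le_rfl⟩, ← hy t₀ ⟨hat, le_rfl⟩] at this
    simp only [intervalIntegral.integral_same, add_zero] at this
    rw [← this]
    refine intervalIntegral.integral_congr_ae ?_
    filter_upwards [dx, dy] with t h1 h2 ht
    have htm := uIoc_subset_uIcc ht
    rw [(h1 htm).deriv, (h2 htm).deriv]
    rw [uIcc_of_le hat] at htm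
    rw [← hx t htm, ← hy t htm]

/-- The energy identity. -/
theorem IsRowSolution.energy (hp : IsPosOn a t₀ h₁ h₂ h₃)
    (hs : IsRowSolution a t₀ h₁ h₂ h₃ r u v) :
    (v t₀ * (starRingEnd ℂ) (u t₀)).im = (v a * (starRingEnd ℂ) (u a)).im +
      r * ∫ s in a..t₀, quadForm (h₁ s) (h₂ s) (h₃ s) (u s) (v s) := by
  have hf := (intervalIntegrable_mul_ofReal hp.le hs.cu hp.i₁).add
        (intervalIntegrable_mul_ofReal hp.le hs.cv hp.i₃)
  have hg := (intervalIntegrable_mul_ofReal hp.le hs.cu hp.i₃).add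
        (intervalIntegrable_mul_ofReal hp.le hs.cv hp.i₂)
  have hre : ∀ {f : ℝ → ℂ}, IntervalIntegrable f volume a t₀ →
      IntervalIntegrable (fun s => (f s).re) volume a t₀ := fun h => ⟨h.1.re, h.2.re⟩
  have him : ∀ {f : ℝ → ℂ}, IntervalIntegrable f volume a t₀ →
      IntervalIntegrable (fun s => (f s).im) volume a t₀ := fun h => ⟨h.1.im, h.2.im⟩
  have ire : ∀ {f : ℝ → ℂ} {t : ℝ}, IntervalIntegrable f volume a t₀ → t ∈ Icc a t₀ →
      (∫ s in a..t, f s).re = ∫ s in a..t, (f s).re := fun h ht =>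
    (Complex.reCLM.intervalIntegral_comp_comm (h.mono_Icc le_rfl ht.1 ht.2)).symm
  have iim : ∀ {f : ℝ → ℂ} {t : ℝ}, IntervalIntegrable f volume a t₀ → t ∈ Icc a t₀ →
      (∫ s in a..t, f s).im = ∫ s in a..t, (f s).im := fun h ht =>
    (Complex.imCLM.intervalIntegral_comp_comm (h.mono_Icc le_rfl ht.1 ht.2)).symm
  have eur : ∀ t ∈ Icc a t₀, (u t).re = (u a).re +
      ∫ s in a..t, r * (u s * (h₃ s : ℂ) + v s * (h₂ s : ℂ)).im := fun t ht => by
    rw [hs.eu t ht, intervalIntegral.integral_const_mul, ← iim hg ht]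
    simp
  have eui : ∀ t ∈ Icc a t₀, (u t).im = (u a).im +
      ∫ s in a..t, -r * (u s * (h₃ s : ℂ) + v s * (h₂ s : ℂ)).re := fun t ht => by
    rw [hs.eu t ht, intervalIntegral.integral_const_mul, ← ire hg ht]
    simp
    ring
  have evr : ∀ t ∈ Icc a t₀, (v t).re = (v a).re +
      ∫ s in a..t, -r * (u s * (h₁ s : ℂ) + v s * (h₃ s : ℂ)).im := fun t ht => by
    rw [hs.ev t ht, intervalIntegral.integral_const_mul, ← iim hf ht]
    simp
  have evi : ∀ t ∈ Icc a t₀, (v t).im = (v a).im +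
      ∫ s in a..t, r * (u s * (h₁ s : ℂ) + v s * (h₃ s : ℂ)).re := fun t ht => by
    rw [hs.ev t ht, intervalIntegral.integral_const_mul, ← ire hf ht]
    simp
  obtain ⟨j1, e1⟩ := mul_sub_mul_eq_integral hp.le ((hre hf).const_mul r) ((him hg).const_mul r)
    evi eur
  obtain ⟨j2, e2⟩ := mul_sub_mul_eq_integral hp.le ((him hf).const_mul (-r))
    ((hre hg).const_mul (-r)) evr eui
  have e3 := intervalIntegral.integral_sub j1 j2
  rw [← e1, ← e2] at e3
  rw [← intervalIntegral.integral_const_mul]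
  have : ∀ s, r * quadForm (h₁ s) (h₂ s) (h₃ s) (u s) (v s) =
      r * (u s * (h₁ s : ℂ) + v s * (h₃ s : ℂ)).re * (u s).re +
        (v s).im * (r * (u s * (h₃ s : ℂ) + v s * (h₂ s : ℂ)).im) -
      (-r * (u s * (h₁ s : ℂ) + v s * (h₃ s : ℂ)).im * (u s).im +
        (v s).re * (-r * (u s * (h₃ s : ℂ) + v s * (h₂ s : ℂ)).re)) := fun s => by
    simp [quadForm, Complex.normSq_apply]
    ring
  simp only [this]
  refine Eq.trans ?_ (congrArg ((v a * (starRingEnd ℂ) (u a)).im + ·) e3.symm)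
  simp
  ring


theorem IsPosOn.ae_quadForm_nonneg (hp : IsPosOn a t₀ h₁ h₂ h₃) (u v : ℝ → ℂ) :
    0 ≤ᵐ[volume.restrict (Icc a t₀)] fun s => quadForm (h₁ s) (h₂ s) (h₃ s) (u s) (v s) := by
  rw [Measure.restrict_congr_set Ioc_ae_eq_Icc.symm]
  filter_upwards [hp.pos] with s ⟨p₁, p₂, p₃⟩ using quadForm_nonneg p₁ p₂ p₃ _ _

theorem intervalIntegral_mono_right {f : ℝ → ℝ} {t : ℝ} (ht : t ∈ Icc a t₀)
    (hf : IntervalIntegrable f volume a t₀) (h0 : 0 ≤ᵐ[volume.restrict (Icc a t₀)] f) :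
    ∫ s in a..t, f s ≤ ∫ s in a..t₀, f s := by
  rw [← intervalIntegral.integral_add_adjacent_intervals (hf.mono_Icc le_rfl ht.1 ht.2)
    (hf.mono_Icc ht.1 ht.2 le_rfl)]
  have := intervalIntegral.integral_nonneg_of_ae_restrict ht.2
    (ae_restrict_of_ae_restrict_of_subset (Icc_subset_Icc_left ht.1) h0)
  linarith

theorem IsPosOn.ae_nonneg (hp : IsPosOn a t₀ h₁ h₂ h₃) :
    0 ≤ᵐ[volume.restrict (Icc a t₀)] h₁ ∧ 0 ≤ᵐ[volume.restrict (Icc a t₀)] h₂ := by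
  rw [Measure.restrict_congr_set Ioc_ae_eq_Icc.symm]
  exact ⟨hp.pos.mono fun s h => h.1, hp.pos.mono fun s h => h.2.1⟩

theorem IsPosOn.integral_quadForm_nonneg (hp : IsPosOn a t₀ h₁ h₂ h₃) (u v : ℝ → ℂ) :
    0 ≤ ∫ s in a..t₀, quadForm (h₁ s) (h₂ s) (h₃ s) (u s) (v s) :=
  intervalIntegral.integral_nonneg_of_ae_restrict hp.le (hp.ae_quadForm_nonneg u v)

/-- The change of a solution is controlled by its energy. -/
theorem IsRowSolution.normSq_sub_le (hp : IsPosOn a t₀ h₁ h₂ h₃)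
    (hs : IsRowSolution a t₀ h₁ h₂ h₃ r u v) :
    Complex.normSq (u t₀ - u a) ≤ r ^ 2 *
      ((∫ s in a..t₀, quadForm (h₁ s) (h₂ s) (h₃ s) (u s) (v s)) * ∫ s in a..t₀, h₂ s) ∧
    Complex.normSq (v t₀ - v a) ≤ r ^ 2 *
      ((∫ s in a..t₀, quadForm (h₁ s) (h₂ s) (h₃ s) (u s) (v s)) * ∫ s in a..t₀, h₁ s) := by
  have hf := (intervalIntegrable_mul_ofReal hp.le hs.cu hp.i₁).add
        (intervalIntegrable_mul_ofReal hp.le hs.cv hp.i₃)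
  have hg := (intervalIntegrable_mul_ofReal hp.le hs.cu hp.i₃).add
        (intervalIntegrable_mul_ofReal hp.le hs.cv hp.i₂)
  have hq := hs.intervalIntegrable_quadForm hp
  have hm : t₀ ∈ Icc a t₀ := ⟨hp.le, le_rfl⟩
  have e1 : u t₀ - u a =
      -(r * Complex.I) * ∫ s in a..t₀, (u s * (h₃ s : ℂ) + v s * (h₂ s : ℂ)) := by
    rw [hs.eu t₀ hm]; ring
  have e2 : v t₀ - v a =
      (r * Complex.I) * ∫ s in a..t₀, (u s * (h₁ s : ℂ) + v s * (h₃ s : ℂ)) := by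
    rw [hs.ev t₀ hm]; ring
  have n1 : Complex.normSq (r * Complex.I) = r ^ 2 := by
    simp [sq]
  rw [e1, e2, map_mul, map_mul, Complex.normSq_neg, n1]
  refine ⟨mul_le_mul_of_nonneg_left ?_ (sq_nonneg r), mul_le_mul_of_nonneg_left ?_ (sq_nonneg r)⟩
  · rw [← Complex.sq_norm]
    refine norm_integral_sq_le hp.le hg hq hp.i₂ ?_
    filter_upwards [hp.pos] with s ⟨p₁, p₂, p₃⟩
    exact ⟨quadForm_nonneg p₁ p₂ p₃ _ _, p₂, normSq_mul_add_mul_le p₃ _ _⟩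
  · rw [← Complex.sq_norm]
    refine norm_integral_sq_le hp.le hf hq hp.i₁ ?_
    filter_upwards [hp.pos] with s ⟨p₁, p₂, p₃⟩
    refine ⟨quadForm_nonneg p₁ p₂ p₃ _ _, p₁, ?_⟩
    rw [quadForm_swap, add_comm]
    exact normSq_mul_add_mul_le (by rwa [mul_comm]) _ _

/-- A lower bound for the energy of a solution in terms of its initial value. -/
theorem IsRowSolution.quadForm_initial_le (hp : IsPosOn a t₀ h₁ h₂ h₃)
    (hs : IsRowSolution a t₀ h₁ h₂ h₃ r u v) :
    quadForm (∫ s in a..t₀, h₁ s) (∫ s in a..t₀, h₂ s) (∫ s in a..t₀, h₃ s) (u a) (v a) ≤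
      (2 + 8 * r ^ 2 * ((∫ s in a..t₀, h₁ s) * ∫ s in a..t₀, h₂ s)) *
        ∫ s in a..t₀, quadForm (h₁ s) (h₂ s) (h₃ s) (u s) (v s) := by
  set E := ∫ s in a..t₀, quadForm (h₁ s) (h₂ s) (h₃ s) (u s) (v s) with hE
  set M₁ := ∫ s in a..t₀, h₁ s with hM₁
  set M₂ := ∫ s in a..t₀, h₂ s with hM₂
  have hq := hs.intervalIntegrable_quadForm hp
  have hE0 : 0 ≤ E := hp.integral_quadForm_nonneg u v
  have hM₁0 : 0 ≤ M₁ := intervalIntegral.integral_nonneg_of_ae_restrict hp.le hp.ae_nonneg.1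
  have hM₂0 : 0 ≤ M₂ := intervalIntegral.integral_nonneg_of_ae_restrict hp.le hp.ae_nonneg.2
  have hd : ∀ t ∈ Icc a t₀, Complex.normSq (u t - u a) ≤ r ^ 2 * (E * M₂) ∧
      Complex.normSq (v t - v a) ≤ r ^ 2 * (E * M₁) := by
    intro t ht
    have h1 := (hs.mono ht.2).normSq_sub_le (hp.mono ht)
    have m1 := intervalIntegral_mono_right ht hp.i₁ hp.ae_nonneg.1
    have m2 := intervalIntegral_mono_right ht hp.i₂ hp.ae_nonneg.2
    have m3 := intervalIntegral_mono_right ht hq (hp.ae_quadForm_nonneg u v)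
    have n1 := intervalIntegral.integral_nonneg_of_ae_restrict ht.1 (hp.mono ht).ae_nonneg.1
    have n2 := intervalIntegral.integral_nonneg_of_ae_restrict ht.1 (hp.mono ht).ae_nonneg.2
    exact ⟨h1.1.trans (mul_le_mul_of_nonneg_left (mul_le_mul m3 m2 n2 hE0) (sq_nonneg r)),
      h1.2.trans (mul_le_mul_of_nonneg_left (mul_le_mul m3 m1 n1 hE0) (sq_nonneg r))⟩
  have e0 : quadForm M₁ M₂ (∫ s in a..t₀, h₃ s) (u a) (v a) =
      ∫ s in a..t₀, quadForm (h₁ s) (h₂ s) (h₃ s) (u a) (v a) := by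
    simp only [quadForm]
    rw [intervalIntegral.integral_add ((hp.i₁.mul_const _).add ((hp.i₃.const_mul 2).mul_const _))
      (hp.i₂.mul_const _), intervalIntegral.integral_add (hp.i₁.mul_const _)
      ((hp.i₃.const_mul 2).mul_const _)]
    simp only [intervalIntegral.integral_mul_const, intervalIntegral.integral_const_mul]
    rfl
  have i0 : IntervalIntegrable (fun s => quadForm (h₁ s) (h₂ s) (h₃ s) (u a) (v a))
      volume a t₀ := by
    simp only [quadForm]
    exact ((hp.i₁.mul_const _).add ((hp.i₃.const_mul 2).mul_const _)).add (hp.i₂.mul_const _)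
  have i1 : IntervalIntegrable (fun s => 4 * (h₁ s * (r ^ 2 * (E * M₂)) +
      h₂ s * (r ^ 2 * (E * M₁)))) volume a t₀ :=
    ((hp.i₁.mul_const _).add (hp.i₂.mul_const _)).const_mul 4
  have hle : ∫ s in a..t₀, quadForm (h₁ s) (h₂ s) (h₃ s) (u a) (v a) ≤
      ∫ s in a..t₀, (2 * quadForm (h₁ s) (h₂ s) (h₃ s) (u s) (v s) +
        4 * (h₁ s * (r ^ 2 * (E * M₂)) + h₂ s * (r ^ 2 * (E * M₁)))) := by
    refine intervalIntegral.integral_mono_ae_restrict hp.le i0 ((hq.const_mul 2).add i1) ?_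
    rw [Measure.restrict_congr_set Ioc_ae_eq_Icc.symm]
    filter_upwards [hp.pos, ae_restrict_mem measurableSet_Ioc] with s ⟨p₁, p₂, p₃⟩ hsm
    obtain ⟨d1, d2⟩ := hd s ⟨hsm.1.le, hsm.2⟩
    have q1 := quadForm_sub_le p₁ p₂ p₃ (u s) (v s) (u s - u a) (v s - v a)
    have q2 := quadForm_le_diag p₁ p₂ p₃ (u s - u a) (v s - v a)
    rw [sub_sub_cancel, sub_sub_cancel] at q1
    have d1' := mul_le_mul_of_nonneg_left d1 p₁
    have d2' := mul_le_mul_of_nonneg_left d2 p₂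
    linarith
  rw [e0]
  refine hle.trans (le_of_eq ?_)
  rw [intervalIntegral.integral_add (hq.const_mul 2) i1, intervalIntegral.integral_const_mul,
    intervalIntegral.integral_const_mul, intervalIntegral.integral_add (hp.i₁.mul_const _)
    (hp.i₂.mul_const _), intervalIntegral.integral_mul_const, intervalIntegral.integral_mul_const,
    ← hE, ← hM₁, ← hM₂]
  ring

/-- For `ir` with `r > 0`, the denominator of the Weyl disk parametrisation does not vanish. -/
theorem IsRowSolution.denom_ne_zero (hr : 0 < r) (hp : IsPosOn a t₀ h₁ h₂ h₃)
    (hs : IsRowSolution a t₀ h₁ h₂ h₃ r u v) (hu : u a = 0) (hv : v a = 1) :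
    u t₀ * Complex.I + v t₀ ≠ 0 := by
  intro h
  have hv' : v t₀ = -(u t₀ * Complex.I) := by linear_combination h
  have he := hs.energy hp
  have hE0 := hp.integral_quadForm_nonneg u v
  have hn := hs.normSq_sub_le hp
  rw [hv', hu, hv] at he
  have e1 : (-(u t₀ * Complex.I) * (starRingEnd ℂ) (u t₀)).im = - Complex.normSq (u t₀) := by
    simp [Complex.normSq_apply]; ring
  rw [e1] at he
  simp only [map_zero, mul_zero, Complex.zero_im, zero_add] at he
  have hE : ∫ s in a..t₀, quadForm (h₁ s) (h₂ s) (h₃ s) (u s) (v s) = 0 := by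
    nlinarith [Complex.normSq_nonneg (u t₀)]
  rw [hE, mul_zero, neg_eq_zero, Complex.normSq_eq_zero] at he
  rw [hE, hv', he, hv] at hn
  norm_num at hn

theorem IsRowSolution.eq_zero (hp : IsPosOn a t₀ h₁ h₂ h₃)
    (hs : IsRowSolution a t₀ h₁ h₂ h₃ r u v) (hu : u a = 0) (hv : v a = 0) :
    u t₀ = 0 ∧ v t₀ = 0 := by
  obtain ⟨-, -, M, hM⟩ := continuousOn_of_integral_equation hp.le hp.i₃ hp.i₂ hp.i₁ hp.i₃
    (fun t ht => by rw [hs.eu t ht, sub_eq_add_neg, ← neg_mul]) hs.ev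
  have := hM t₀ ⟨hp.le, le_rfl⟩
  rw [hu, hv, norm_zero, add_zero, mul_zero] at this
  exact ⟨norm_eq_zero.1 (le_antisymm (by linarith [norm_nonneg (v t₀)]) (norm_nonneg _)),
    norm_eq_zero.1 (le_antisymm (by linarith [norm_nonneg (u t₀)]) (norm_nonneg _))⟩

/-- Every solution is a combination of the two rows of the fundamental solution. -/
theorem IsRowSolution.eq_combination (hp : IsPosOn a t₀ h₁ h₂ h₃)
    (hs : IsRowSolution a t₀ h₁ h₂ h₃ r u v) {w₁ w₂ w₃ w₄ : ℝ → ℂ}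
    (hw : IsRowSolution a t₀ h₁ h₂ h₃ r w₁ w₂) (hw' : IsRowSolution a t₀ h₁ h₂ h₃ r w₃ w₄)
    (e₁ : w₁ a = 1) (e₂ : w₂ a = 0) (e₃ : w₃ a = 0) (e₄ : w₄ a = 1) :
    u t₀ = u a * w₁ t₀ + v a * w₃ t₀ ∧ v t₀ = u a * w₂ t₀ + v a * w₄ t₀ := by
  have := ((hs.linear hp hw (u a)).linear hp hw' (v a)).eq_zero hp
    (by simp [e₁, e₃]) (by simp [e₂, e₄])
  exact ⟨by linear_combination this.1, by linear_combination this.2⟩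

/-- Rotating the Hamiltonian rotates the row solutions. -/
theorem IsRowSolution.rotate (hp : IsPosOn a t₀ h₁ h₂ h₃)
    (hs : IsRowSolution a t₀ h₁ h₂ h₃ r u v) {k l : ℝ} (hkl : k ^ 2 + l ^ 2 = 1) :
    IsRowSolution a t₀ (fun s => k ^ 2 * h₁ s - 2 * k * l * h₃ s + l ^ 2 * h₂ s)
      (fun s => l ^ 2 * h₁ s + 2 * k * l * h₃ s + k ^ 2 * h₂ s)
      (fun s => k * l * h₁ s + (k ^ 2 - l ^ 2) * h₃ s - k * l * h₂ s) r
      (fun s => k * u s - l * v s) (fun s => l * u s + k * v s) := by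
  have hkl' : (k : ℂ) ^ 2 + (l : ℂ) ^ 2 = 1 := by exact_mod_cast hkl
  refine ⟨(continuousOn_const.mul hs.cu).sub (continuousOn_const.mul hs.cv),
    (continuousOn_const.mul hs.cu).add (continuousOn_const.mul hs.cv), fun t ht => ?_,
    fun t ht => ?_⟩
  all_goals
    have hpt := hp.mono ht
    have hst := hs.mono ht.2
    have jf := (intervalIntegrable_mul_ofReal ht.1 hst.cu hpt.i₁).add
      (intervalIntegrable_mul_ofReal ht.1 hst.cv hpt.i₃)
    have jg := (intervalIntegrable_mul_ofReal ht.1 hst.cu hpt.i₃).add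
      (intervalIntegrable_mul_ofReal ht.1 hst.cv hpt.i₂)
  · have e : ∀ s, (k * u s - l * v s) *
          ((k * l * h₁ s + (k ^ 2 - l ^ 2) * h₃ s - k * l * h₂ s : ℝ) : ℂ) +
        (l * u s + k * v s) * ((l ^ 2 * h₁ s + 2 * k * l * h₃ s + k ^ 2 * h₂ s : ℝ) : ℂ) =
        l * (u s * (h₁ s : ℂ) + v s * (h₃ s : ℂ)) +
          k * (u s * (h₃ s : ℂ) + v s * (h₂ s : ℂ)) := fun s => by
      push_cast
      linear_combination (l * (u s * (h₁ s : ℂ) + v s * (h₃ s : ℂ)) +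
          k * (u s * (h₃ s : ℂ) + v s * (h₂ s : ℂ))) * hkl'
    simp only [e]
    rw [intervalIntegral.integral_add (jf.const_mul _) (jg.const_mul _),
      intervalIntegral.integral_const_mul, intervalIntegral.integral_const_mul, hs.eu t ht,
      hs.ev t ht]
    ring
  · have e : ∀ s, (k * u s - l * v s) *
          ((k ^ 2 * h₁ s - 2 * k * l * h₃ s + l ^ 2 * h₂ s : ℝ) : ℂ) +
        (l * u s + k * v s) *
          ((k * l * h₁ s + (k ^ 2 - l ^ 2) * h₃ s - k * l * h₂ s : ℝ) : ℂ) =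
        k * (u s * (h₁ s : ℂ) + v s * (h₃ s : ℂ)) -
          l * (u s * (h₃ s : ℂ) + v s * (h₂ s : ℂ)) := fun s => by
      push_cast
      linear_combination (k * (u s * (h₁ s : ℂ) + v s * (h₃ s : ℂ)) -
          l * (u s * (h₃ s : ℂ) + v s * (h₂ s : ℂ))) * hkl'
    simp only [e]
    rw [intervalIntegral.integral_sub (jf.const_mul _) (jg.const_mul _),
      intervalIntegral.integral_const_mul, intervalIntegral.integral_const_mul, hs.eu t ht,
      hs.ev t ht]
    ring

end RowSolution

/-- The basic estimate for points of the Weyl disk. -/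
theorem weylDisk_estimate {a t₀ r : ℝ} {h₁ h₂ h₃ : ℝ → ℝ} {u v u' v' : ℝ → ℂ} (hr : 0 < r)
    (hp : IsPosOn a t₀ h₁ h₂ h₃)
    (hs : IsRowSolution a t₀ h₁ h₂ h₃ r u v) (hu : u a = 1) (hv : v a = 0)
    (hs' : IsRowSolution a t₀ h₁ h₂ h₃ r u' v') (hu' : u' a = 0) (hv' : v' a = 1)
    {q : ℂ} (hq : q = (u t₀ * Complex.I + v t₀) / (u' t₀ * Complex.I + v' t₀)) :
    0 ≤ q.im ∧ ∀ t ∈ Icc a t₀,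
      quadForm (∫ s in a..t, h₁ s) (∫ s in a..t, h₂ s) (∫ s in a..t, h₃ s) 1 (-q) ≤
      (2 + 8 * r ^ 2 * ((∫ s in a..t, h₁ s) * ∫ s in a..t, h₂ s)) * (q.im / r) := by
  have hne := hs'.denom_ne_zero hr hp hu' hv'
  rw [eq_div_iff hne] at hq
  have hS := hs.linear hp hs' q
  have he := hS.energy hp
  have hE0 := hp.integral_quadForm_nonneg (fun t => u t - q * u' t) (fun t => v t - q * v' t)
  have hv2 : v t₀ - q * v' t₀ = -((u t₀ - q * u' t₀) * Complex.I) := by linear_combination -hq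
  simp only [hv2, hu, hv, hu', hv'] at he
  have e1 : ∀ x : ℂ, (-(x * Complex.I) * (starRingEnd ℂ) x).im = - Complex.normSq x := fun x => by
    simp [Complex.normSq_apply]; ring
  rw [e1] at he
  simp only [mul_zero, sub_zero, mul_one, zero_sub, map_one, Complex.neg_im] at he
  have hn := Complex.normSq_nonneg (u t₀ - q * u' t₀)
  have hEq : (∫ s in a..t₀, quadForm (h₁ s) (h₂ s) (h₃ s) (u s - q * u' s) (v s - q * v' s)) ≤
      q.im / r := by
    rw [le_div_iff₀ hr]; linarith
  refine ⟨by nlinarith, fun t ht => ?_⟩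
  have hpt := hp.mono ht
  have h1 := (hS.mono ht.2).quadForm_initial_le hpt
  simp only [hu, hv, hu', hv', mul_zero, sub_zero, mul_one, zero_sub] at h1
  refine h1.trans (mul_le_mul_of_nonneg_left ?_ ?_)
  · exact (intervalIntegral_mono_right ht (hS.intervalIntegrable_quadForm hp)
      (hp.ae_quadForm_nonneg _ _)).trans hEq
  · have n1 := intervalIntegral.integral_nonneg_of_ae_restrict ht.1 hpt.ae_nonneg.1
    have n2 := intervalIntegral.integral_nonneg_of_ae_restrict ht.1 hpt.ae_nonneg.2
    positivity

section Hamiltonian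

variable {a t r : ℝ} {b : EReal} {H : ℝ → Matrix (Fin 2) (Fin 2) ℝ}

theorem toBFilter_neBot (hab : (a : EReal) < b) : (toBFilter b).NeBot := by
  refine comap_neBot fun s hs => ?_
  obtain ⟨l, hl, hls⟩ := (mem_nhdsLT_iff_exists_Ioo_subset' hab).1 hs
  obtain ⟨x, hx₁, hx₂⟩ := EReal.lt_iff_exists_real_btwn.1 hl
  exact ⟨x, hls ⟨hx₁, hx₂⟩⟩

theorem eventually_toBFilter (ht : (t : EReal) < b) :
    ∀ᶠ x in toBFilter b, t ≤ x ∧ (x : EReal) < b := by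
  have : ∀ᶠ y : EReal in nhdsWithin b (Set.Iio b), (t : EReal) < y ∧ y < b :=
    Ioo_mem_nhdsLT ht
  filter_upwards [this.comap _] with x hx
  exact ⟨by exact_mod_cast hx.1.le, hx.2⟩

theorem posSemidef_entries {M : Matrix (Fin 2) (Fin 2) ℝ} (hM : M.PosSemidef) :
    0 ≤ M 0 0 ∧ 0 ≤ M 1 1 ∧ M 0 1 ^ 2 ≤ M 0 0 * M 1 1 ∧ M 1 0 = M 0 1 := by
  have hs : M 1 0 = M 0 1 := by simpa using hM.isHermitian.apply 0 1
  have hd := hM.det_nonneg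
  rw [Matrix.det_fin_two, hs] at hd
  exact ⟨hM.diag_nonneg, hM.diag_nonneg, by nlinarith, hs⟩

theorem IsHamiltonian.ae_entries (hH : IsHamiltonian a b H) (htb : (t : EReal) < b) :
    ∀ᵐ s ∂volume.restrict (Ioc a t), 0 ≤ H s 0 0 ∧ 0 ≤ H s 1 1 ∧
      H s 0 1 ^ 2 ≤ H s 0 0 * H s 1 1 ∧ H s 1 0 = H s 0 1 := by
  rw [ae_restrict_iff' measurableSet_Ioc]
  filter_upwards [hH.posSemidef] with s hs hst
  exact posSemidef_entries
    (hs hst.1.le (lt_of_le_of_lt (EReal.coe_le_coe_iff.2 hst.2) htb))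

theorem IsHamiltonian.isPosOn (hH : IsHamiltonian a b H) (hat : a ≤ t) (htb : (t : EReal) < b) :
    IsPosOn a t (fun s => H s 0 0) (fun s => H s 1 1) (fun s => H s 0 1) where
  le := hat
  i₁ := hH.locInt 0 0 t hat htb
  i₂ := hH.locInt 1 1 t hat htb
  i₃ := hH.locInt 0 1 t hat htb
  pos := (hH.ae_entries htb).mono fun _ hs => ⟨hs.1, hs.2.1, hs.2.2.1⟩

/-- Conjugation by a rotation preserves Hamiltonians. -/
theorem IsHamiltonian.conj (hH : IsHamiltonian a b H) {Q : Matrix (Fin 2) (Fin 2) ℝ}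
    (hQ : Qᵀ * Q = 1) {Ht : ℝ → Matrix (Fin 2) (Fin 2) ℝ} (hHt : ∀ t, Ht t = Q * H t * Qᵀ) :
    IsHamiltonian a b Ht where
  a_lt_b := hH.a_lt_b
  posSemidef := by
    filter_upwards [hH.posSemidef] with t ht h₁ h₂
    rw [hHt]
    simpa [Matrix.conjTranspose_eq_transpose_of_trivial] using
      (ht h₁ h₂).mul_mul_conjTranspose_same Q
  locInt i j t h₁ h₂ := by
    simp only [hHt, Matrix.mul_apply, Fin.sum_univ_two, Matrix.transpose_apply]
    have := fun i j => hH.locInt i j t h₁ h₂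
    exact ((((this 0 0).const_mul _).add ((this 1 0).const_mul _)).mul_const _).add
      ((((this 0 1).const_mul _).add ((this 1 1).const_mul _)).mul_const _)
  zero_null := by
    refine measure_mono_null ?_ hH.zero_null
    rintro t ⟨h₁, h₂, h₃⟩
    refine ⟨h₁, h₂, ?_⟩
    have : Qᵀ * Ht t * Q = H t := by
      rw [hHt, ← mul_assoc, ← mul_assoc, hQ, one_mul, mul_assoc, hQ, mul_one]
    rw [← this, h₃, mul_zero, zero_mul]
  limit_point := by
    rw [← hH.limit_point]
    congr 1
    ext t
    rw [hHt, Matrix.trace_mul_comm, ← mul_assoc, hQ, one_mul]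

theorem IsRowSolution.congr {t₀ : ℝ} {h₁ h₂ h₃ k₁ k₂ k₃ : ℝ → ℝ} {u v : ℝ → ℂ}
    (hs : IsRowSolution a t₀ h₁ h₂ h₃ r u v)
    (h : ∀ᵐ s ∂volume.restrict (Ioc a t₀), h₁ s = k₁ s ∧ h₂ s = k₂ s ∧ h₃ s = k₃ s) :
    IsRowSolution a t₀ k₁ k₂ k₃ r u v where
  cu := hs.cu
  cv := hs.cv
  eu t ht := by
    rw [hs.eu t ht]
    congr 2
    refine intervalIntegral.integral_congr_ae_restrict ?_
    rw [uIoc_of_le ht.1]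
    filter_upwards [ae_restrict_of_ae_restrict_of_subset (Ioc_subset_Ioc_right ht.2) h] with s hs
    rw [hs.2.1, hs.2.2]
  ev t ht := by
    rw [hs.ev t ht]
    congr 2
    refine intervalIntegral.integral_congr_ae_restrict ?_
    rw [uIoc_of_le ht.1]
    filter_upwards [ae_restrict_of_ae_restrict_of_subset (Ioc_subset_Ioc_right ht.2) h] with s hs
    rw [hs.1, hs.2.2]

variable {W : ℝ → ℂ → Matrix (Fin 2) (Fin 2) ℂ}

theorem IsFundamentalSolution.apply_left (hH : IsHamiltonian a b H)
    (hW : IsFundamentalSolution a b H W) (z : ℂ) : W a z = 1 := by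
  have h := hW z a le_rfl hH.a_lt_b
  ext i j
  have h0 := congrFun₂ h i 0
  have h1 := congrFun₂ h i 1
  fin_cases i <;> fin_cases j <;>
    simp [JmatC, Matrix.mul_apply, Fin.sum_univ_two] at h0 h1 ⊢
  · linear_combination -h1
  · exact h0
  · exact h1
  · linear_combination h0

theorem IsFundamentalSolution.isRowSolution (hH : IsHamiltonian a b H)
    (hW : IsFundamentalSolution a b H W) (i : Fin 2) (r : ℝ) (hat : a ≤ t)
    (htb : (t : EReal) < b) :
    IsRowSolution a t (fun s => H s 0 0) (fun s => H s 1 1) (fun s => H s 0 1) r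
      (fun s => W s (r * Complex.I) i 0) (fun s => W s (r * Complex.I) i 1) := by
  set z : ℂ := r * Complex.I
  have hWa := hW.apply_left hH z
  have key : ∀ x ∈ Icc a t,
      W x z i 0 = W a z i 0 + (-z) *
        ∫ s in a..x, (W s z i 0 * (H s 0 1 : ℂ) + W s z i 1 * (H s 1 1 : ℂ)) ∧
      W x z i 1 = W a z i 1 + z *
        ∫ s in a..x, (W s z i 0 * (H s 0 0 : ℂ) + W s z i 1 * (H s 1 0 : ℂ)) := by
    intro x hx
    have h := hW z x hx.1 (lt_of_le_of_lt (EReal.coe_le_coe_iff.2 hx.2) htb)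
    have h0 := congrFun₂ h i 0
    have h1 := congrFun₂ h i 1
    rw [hWa]
    simp only [JmatC, Matrix.sub_apply, Matrix.smul_apply, Matrix.mul_apply, Fin.sum_univ_two,
      Matrix.of_apply, Matrix.map_apply, smul_eq_mul] at h0 h1
    obtain rfl | rfl : i = 0 ∨ i = 1 := by omega
    all_goals simp at h0 h1 ⊢
    · exact ⟨by linear_combination -h1, by linear_combination h0⟩
    · exact ⟨by linear_combination -h1, by linear_combination h0⟩
  obtain ⟨cu, cv, -⟩ := continuousOn_of_integral_equation hat (hH.locInt 0 1 t hat htb)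
    (hH.locInt 1 1 t hat htb) (hH.locInt 0 0 t hat htb) (hH.locInt 1 0 t hat htb)
    (fun x hx => (key x hx).1) (fun x hx => (key x hx).2)
  refine ⟨cu, cv, fun x hx => ?_, fun x hx => ?_⟩
  · rw [(key x hx).1, neg_mul, ← sub_eq_add_neg]
  · rw [(key x hx).2]
    congr 2
    refine intervalIntegral.integral_congr_ae_restrict ?_
    rw [uIoc_of_le hx.1]
    filter_upwards [ae_restrict_of_ae_restrict_of_subset (Ioc_subset_Ioc_right hx.2)
      (hH.ae_entries htb)] with s hs
    rw [hs.2.2.2]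

variable {qH : ℂ → ℂ}

/-- The Weyl coefficient inherits the Weyl disk estimates. -/
theorem IsWeylCoefficient.estimate (hH : IsHamiltonian a b H) (hq : IsWeylCoefficient a b H qH)
    (hr : 0 < r) :
    0 ≤ (qH (r * Complex.I)).im ∧ ∀ t, a ≤ t → (t : EReal) < b →
      quadForm (m1 a H t) (m2 a H t) (m3 a H t) 1 (-qH (r * Complex.I)) ≤
      (2 + 8 * r ^ 2 * (m1 a H t * m2 a H t)) * ((qH (r * Complex.I)).im / r) := by
  obtain ⟨W, hW, hlim⟩ := hq
  have hne := toBFilter_neBot hH.a_lt_b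
  have hl := hlim (r * Complex.I) (by simpa using hr.ne') Complex.I (by simp)
  have hWa := hW.apply_left hH (r * Complex.I)
  have key : ∀ x, a ≤ x → (x : EReal) < b → _ := fun x hx hxb =>
    weylDisk_estimate hr (hH.isPosOn hx hxb) (hW.isRowSolution hH 0 r hx hxb)
      (by simp [hWa]) (by simp [hWa]) (hW.isRowSolution hH 1 r hx hxb) (by simp [hWa])
      (by simp [hWa]) rfl
  have him := (Complex.continuous_im.tendsto _).comp hl
  refine ⟨ge_of_tendsto him ?_, fun t hat htb => ?_⟩
  · filter_upwards [eventually_toBFilter hH.a_lt_b] with x hx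
    exact (key x hx.1 hx.2).1
  · have hre := (Complex.continuous_re.tendsto _).comp hl
    refine le_of_tendsto_of_tendsto (b := toBFilter b) (f := fun x => quadForm (m1 a H t)
      (m2 a H t) (m3 a H t) 1 (-((W x (r * Complex.I) 0 0 * Complex.I + W x (r * Complex.I) 0 1) /
        (W x (r * Complex.I) 1 0 * Complex.I + W x (r * Complex.I) 1 1))))
      ?_ ((him.div_const r).const_mul (2 + 8 * r ^ 2 * (m1 a H t * m2 a H t))) ?_
    · have hc : Continuous fun y : ℂ => quadForm (m1 a H t) (m2 a H t) (m3 a H t) 1 (-y) := by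
        unfold quadForm
        simp only [Complex.normSq_apply]
        fun_prop
      exact (hc.tendsto _).comp hl
    · filter_upwards [eventually_toBFilter htb] with x hx
      exact (key x (hat.trans hx.1) hx.2).2 t ⟨hat, hx.1⟩

end Hamiltonian

section Rotation

variable {a t r k l : ℝ} {b : EReal} {H Ht : ℝ → Matrix (Fin 2) (Fin 2) ℝ}

theorem ae_rotation_entries (hH : IsHamiltonian a b H) (htb : (t : EReal) < b)
    (hHt : ∀ t, Ht t = !![k, -l; l, k] * H t * !![k, -l; l, k]ᵀ) :
    ∀ᵐ s ∂volume.restrict (Ioc a t),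
      k ^ 2 * H s 0 0 - 2 * k * l * H s 0 1 + l ^ 2 * H s 1 1 = Ht s 0 0 ∧
      l ^ 2 * H s 0 0 + 2 * k * l * H s 0 1 + k ^ 2 * H s 1 1 = Ht s 1 1 ∧
      k * l * H s 0 0 + (k ^ 2 - l ^ 2) * H s 0 1 - k * l * H s 1 1 = Ht s 0 1 := by
  filter_upwards [hH.ae_entries htb] with s hs
  obtain ⟨-, -, -, hs⟩ := hs
  rw [hHt]
  simp [Matrix.mul_apply, Fin.sum_univ_two, Matrix.vecMul, dotProduct, hs]
  refine ⟨by ring, by ring, by ring⟩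

theorem rotation_primitives (hH : IsHamiltonian a b H) (hat : a ≤ t) (htb : (t : EReal) < b)
    (hHt : ∀ t, Ht t = !![k, -l; l, k] * H t * !![k, -l; l, k]ᵀ) :
    m1 a Ht t = k ^ 2 * m1 a H t - 2 * k * l * m3 a H t + l ^ 2 * m2 a H t ∧
    m2 a Ht t = l ^ 2 * m1 a H t + 2 * k * l * m3 a H t + k ^ 2 * m2 a H t ∧
    m3 a Ht t = k * l * m1 a H t + (k ^ 2 - l ^ 2) * m3 a H t - k * l * m2 a H t := by
  have h := ae_rotation_entries hH htb hHt
  have i₁ := hH.locInt 0 0 t hat htb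
  have i₂ := hH.locInt 1 1 t hat htb
  have i₃ := hH.locInt 0 1 t hat htb
  simp only [m1, m2, m3]
  refine ⟨?_, ?_, ?_⟩
  · rw [← intervalIntegral.integral_const_mul, ← intervalIntegral.integral_const_mul,
      ← intervalIntegral.integral_const_mul,
      ← intervalIntegral.integral_sub (i₁.const_mul _) (i₃.const_mul _),
      ← intervalIntegral.integral_add ((i₁.const_mul _).sub (i₃.const_mul _)) (i₂.const_mul _)]
    refine intervalIntegral.integral_congr_ae_restrict ?_
    rw [uIoc_of_le hat]
    exact h.mono fun s hs => hs.1.symm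
  · rw [← intervalIntegral.integral_const_mul, ← intervalIntegral.integral_const_mul,
      ← intervalIntegral.integral_const_mul,
      ← intervalIntegral.integral_add (i₁.const_mul _) (i₃.const_mul _),
      ← intervalIntegral.integral_add ((i₁.const_mul _).add (i₃.const_mul _)) (i₂.const_mul _)]
    refine intervalIntegral.integral_congr_ae_restrict ?_
    rw [uIoc_of_le hat]
    exact h.mono fun s hs => hs.2.1.symm
  · rw [← intervalIntegral.integral_const_mul, ← intervalIntegral.integral_const_mul,
      ← intervalIntegral.integral_const_mul,
      ← intervalIntegral.integral_add (i₁.const_mul _) (i₃.const_mul _),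
      ← intervalIntegral.integral_sub ((i₁.const_mul _).add (i₃.const_mul _)) (i₂.const_mul _)]
    refine intervalIntegral.integral_congr_ae_restrict ?_
    rw [uIoc_of_le hat]
    exact h.mono fun s hs => hs.2.2.symm

theorem transpose_mul_rotation (hkl : k ^ 2 + l ^ 2 = 1) :
    (!![k, -l; l, k] : Matrix (Fin 2) (Fin 2) ℝ)ᵀ * !![k, -l; l, k] = 1 := by
  ext i j
  fin_cases i <;> fin_cases j <;> simp [Matrix.mul_apply, Fin.sum_univ_two] <;> linarith

/-- Rotating the Hamiltonian acts on the Weyl coefficient by a Möbius transformation. -/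
theorem weylCoefficient_rotation (hH : IsHamiltonian a b H) (hkl : k ^ 2 + l ^ 2 = 1)
    (hHt : ∀ t, Ht t = !![k, -l; l, k] * H t * !![k, -l; l, k]ᵀ) {qH qHt : ℂ → ℂ}
    (hq : IsWeylCoefficient a b H qH) (hqt : IsWeylCoefficient a b Ht qHt) (hr : 0 < r) :
    k * qH (r * Complex.I) - l = qHt (r * Complex.I) * (k + l * qH (r * Complex.I)) := by
  have hHt' := hH.conj (transpose_mul_rotation hkl) hHt
  obtain ⟨W, hW, hlim⟩ := hq
  obtain ⟨V, hV, hlimt⟩ := hqt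
  have hne := toBFilter_neBot hH.a_lt_b
  set z : ℂ := r * Complex.I with hz
  have hzi : z.im ≠ 0 := by simpa [hz] using hr.ne'
  have hl := hlim z hzi Complex.I (by simp)
  have hlt := hlimt z hzi Complex.I (by simp)
  have hWa := hW.apply_left hH z
  have hVa := hV.apply_left hHt' z
  refine tendsto_nhds_unique_of_eventuallyEq ((hl.const_mul (k : ℂ)).sub_const (l : ℂ))
    (hlt.mul ((hl.const_mul (l : ℂ)).const_add (k : ℂ))) ?_
  filter_upwards [eventually_toBFilter hH.a_lt_b] with x hx
  have hp := hH.isPosOn hx.1 hx.2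
  have hpt := hHt'.isPosOn hx.1 hx.2
  have hd := (hW.isRowSolution hH 1 r hx.1 hx.2).denom_ne_zero hr hp
    (by simp [← hz, hWa]) (by simp [← hz, hWa])
  have hdt := (hV.isRowSolution hHt' 1 r hx.1 hx.2).denom_ne_zero hr hpt
    (by simp [← hz, hVa]) (by simp [← hz, hVa])
  have hae := ae_rotation_entries hH hx.2 hHt
  have key := fun i => (((hW.isRowSolution hH i r hx.1 hx.2).rotate hp hkl).congr
    hae).eq_combination hpt (hV.isRowSolution hHt' 0 r hx.1 hx.2)
    (hV.isRowSolution hHt' 1 r hx.1 hx.2)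
    (by simp [← hz, hVa]) (by simp [← hz, hVa]) (by simp [← hz, hVa]) (by simp [← hz, hVa])
  have k0 := key 0
  have k1 := key 1
  simp only [← hz, hWa] at k0 k1 hd hdt
  simp at k0 k1
  obtain ⟨e₁, e₂⟩ := k0
  obtain ⟨e₃, e₄⟩ := k1
  have hkl' : (k : ℂ) ^ 2 + (l : ℂ) ^ 2 = 1 := by exact_mod_cast hkl
  set N := W x z 0 0 * Complex.I + W x z 0 1
  set D := W x z 1 0 * Complex.I + W x z 1 1
  set N' := V x z 0 0 * Complex.I + V x z 0 1
  set D' := V x z 1 0 * Complex.I + V x z 1 1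
  have f₁ : (k - l * Complex.I) * N = k * N' + l * D' := by
    simp only [N, N', D']
    linear_combination Complex.I * e₁ + e₂ - l * W x z 0 0 * Complex.I_sq
  have f₂ : (k - l * Complex.I) * D = -l * N' + k * D' := by
    simp only [D, N', D']
    linear_combination Complex.I * e₃ + e₄ - l * W x z 1 0 * Complex.I_sq
  have g₁ : (k - l * Complex.I) * (k * N - l * D) = N' := by
    linear_combination k * f₁ - l * f₂ + N' * hkl'
  have g₂ : (k - l * Complex.I) * (k * D + l * N) = D' := by
    linear_combination k * f₂ + l * f₁ + D' * hkl'
  have hω : (k - l * Complex.I) ≠ 0 := by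
    intro h0
    exact hdt (by rw [← g₂, h0, zero_mul])
  have hkD : k * D + l * N ≠ 0 := fun h0 => hdt (by rw [← g₂, h0, mul_zero])
  rw [← g₁, ← g₂, mul_div_mul_left _ _ hω,
    show (k : ℂ) + l * (N / D) = (k * D + l * N) / D by field_simp, div_mul_div_cancel₀ hkD]
  field_simp

end Rotation

section Comparison

variable {a t t' r κ : ℝ} {b : EReal} {H Ht : ℝ → Matrix (Fin 2) (Fin 2) ℝ}

/-- The quadratic forms `M(t)` are nondecreasing in `t`. -/
theorem IsHamiltonian.primitive_mono (hH : IsHamiltonian a b H) (hat : a ≤ t) (htt : t ≤ t')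
    (htb : (t' : EReal) < b) (x y : ℝ) :
    x ^ 2 * m1 a H t + 2 * x * y * m3 a H t + y ^ 2 * m2 a H t ≤
      x ^ 2 * m1 a H t' + 2 * x * y * m3 a H t' + y ^ 2 * m2 a H t' := by
  have key : ∀ s ∈ Icc a t', x ^ 2 * m1 a H s + 2 * x * y * m3 a H s + y ^ 2 * m2 a H s =
      ∫ w in a..s, (x ^ 2 * H w 0 0 + 2 * x * y * H w 0 1 + y ^ 2 * H w 1 1) := by
    intro s hs
    have hp := (hH.isPosOn (hat.trans htt) htb).mono hs
    have i₁ := hp.i₁.const_mul (x ^ 2)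
    have i₂ := hp.i₂.const_mul (y ^ 2)
    have i₃ := hp.i₃.const_mul (2 * x * y)
    rw [intervalIntegral.integral_add (i₁.add i₃) i₂, intervalIntegral.integral_add i₁ i₃]
    simp only [intervalIntegral.integral_const_mul, m1, m2, m3]
  have hp := hH.isPosOn (hat.trans htt) htb
  rw [key t ⟨hat, htt⟩, key t' ⟨hat.trans htt, le_rfl⟩]
  refine intervalIntegral.integral_mono_interval le_rfl hat htt ?_
    (((hp.i₁.const_mul _).add (hp.i₃.const_mul _)).add (hp.i₂.const_mul _))
  filter_upwards [hp.pos] with s hs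
  have := real_quadForm_nonneg hs.1 hs.2.1 hs.2.2 x y
  simp only [Pi.zero_apply]
  linarith

theorem sqrt_div_spec {x y δ : ℝ} (hx : 0 ≤ x) (hδ : 0 < δ) (hxy : x * y = δ ^ 2) :
    0 < √(x / y) ∧ x = √(x / y) * δ ∧ y * √(x / y) = δ := by
  have hx' : 0 < x := by
    refine hx.lt_of_ne fun h => ?_
    rw [← h, zero_mul] at hxy
    exact (pow_pos hδ 2).ne hxy
  have hy : y = δ ^ 2 / x := by field_simp; linarith
  have h : √(x / y) = x / δ := by
    rw [hy, show x / (δ ^ 2 / x) = (x / δ) ^ 2 by field_simp, Real.sqrt_sq (by positivity)]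
  rw [h, hy]
  refine ⟨by positivity, by field_simp, by field_simp⟩

/-- At the point where `m₁ m₂ = κ² / (4 r²)`, the quotient `√(m₁ / m₂)` is comparable to the
modulus of the Weyl coefficient at `ir`. -/
theorem IsHamiltonian.sqrt_div_comparable (hH : IsHamiltonian a b H) {qH : ℂ → ℂ}
    (hq : IsWeylCoefficient a b H qH) (hr : 0 < r) (hκ : 0 < κ) (hat : a ≤ t)
    (htb : (t : EReal) < b) (hm : m1 a H t * m2 a H t = κ ^ 2 / (4 * r ^ 2)) :
    (0 < √(m1 a H t / m2 a H t) ∧ m1 a H t = √(m1 a H t / m2 a H t) * (κ / (2 * r)) ∧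
      m2 a H t * √(m1 a H t / m2 a H t) = κ / (2 * r)) ∧
    √(m1 a H t / m2 a H t) ≤ (2 + 4 * (1 + κ ^ 2) / κ) * ‖qH (r * Complex.I)‖ ∧
    ‖qH (r * Complex.I)‖ ≤ (2 + 4 * (1 + κ ^ 2) / κ) * √(m1 a H t / m2 a H t) := by
  have hmono := hH.primitive_mono le_rfl hat htb
  simp only [m1, m2, m3, intervalIntegral.integral_same, mul_zero, add_zero] at hmono
  change ∀ x y, 0 ≤ x ^ 2 * m1 a H t + 2 * x * y * m3 a H t + y ^ 2 * m2 a H t at hmono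
  have hx : 0 ≤ m1 a H t := by simpa using hmono 1 0
  obtain ⟨him, hest⟩ := hq.estimate hH hr
  have hest := hest t hat htb
  have hδ : 0 < κ / (2 * r) := by positivity
  have hm' : m1 a H t * m2 a H t = (κ / (2 * r)) ^ 2 := by rw [hm]; field_simp; norm_num
  have hspec := sqrt_div_spec hx hδ hm'
  refine ⟨hspec, ?_⟩
  obtain ⟨hA, h₁, h₂⟩ := hspec
  set A := √(m1 a H t / m2 a H t)
  set δ := κ / (2 * r) with hδdef
  set p := qH (r * Complex.I)
  set B := 2 + 4 * (1 + κ ^ 2) / κ with hB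
  have h₂' : m2 a H t = δ / A := by field_simp; linarith
  have hm3 : |m3 a H t| ≤ δ := by
    rw [abs_le]
    have e₁ := hmono 1 A
    have e₂ := hmono 1 (-A)
    rw [h₁, h₂'] at e₁ e₂
    have e : A ^ 2 * (δ / A) = A * δ := by field_simp
    constructor <;> nlinarith
  have hpn : 0 ≤ ‖p‖ := norm_nonneg p
  have hre : m3 a H t * p.re ≤ δ * ‖p‖ := by
    calc m3 a H t * p.re ≤ |m3 a H t| * |p.re| := by rw [← abs_mul]; exact le_abs_self _
      _ ≤ δ * ‖p‖ := by gcongr; exact Complex.abs_re_le_norm p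
  have himn : p.im ≤ ‖p‖ := (le_abs_self _).trans (Complex.abs_im_le_norm p)
  have hquad : quadForm (m1 a H t) (m2 a H t) (m3 a H t) 1 (-p) =
      m1 a H t - 2 * (m3 a H t * p.re) + m2 a H t * ‖p‖ ^ 2 := by
    simp only [quadForm, Complex.sq_norm, Complex.normSq_neg, Complex.normSq_one, Complex.one_re,
      Complex.one_im, Complex.neg_re, Complex.neg_im]
    ring
  rw [hquad, hm] at hest
  have hrhs : (2 + 8 * r ^ 2 * (κ ^ 2 / (4 * r ^ 2))) * (p.im / r) ≤
      δ * (4 * (1 + κ ^ 2) / κ) * ‖p‖ := by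
    have : (2 + 8 * r ^ 2 * (κ ^ 2 / (4 * r ^ 2))) * (p.im / r) =
        δ * (4 * (1 + κ ^ 2) / κ) * p.im := by
      rw [hδdef]; field_simp; ring
    rw [this]
    gcongr
  have hmain : A ^ 2 + ‖p‖ ^ 2 ≤ B * (A * ‖p‖) := by
    have h : A * δ + δ / A * ‖p‖ ^ 2 ≤ δ * B * ‖p‖ := by
      rw [← h₂', ← h₁, hB]; linarith
    have h' := mul_le_mul_of_nonneg_left h (div_pos hA hδ).le
    have e₁ : A / δ * (A * δ + δ / A * ‖p‖ ^ 2) = A ^ 2 + ‖p‖ ^ 2 := by field_simp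
    have e₂ : A / δ * (δ * B * ‖p‖) = B * (A * ‖p‖) := by field_simp
    rwa [e₁, e₂] at h'
  constructor
  · refine le_of_mul_le_mul_left ?_ hA
    nlinarith [sq_nonneg ‖p‖]
  · rcases hpn.eq_or_lt with h0 | h0
    · rw [← h0]; positivity
    · refine le_of_mul_le_mul_left ?_ h0
      nlinarith [sq_nonneg A]

/-- The normalised determinant can only grow, up to the factor `1 + m₁ / m₂`, under a rotation
and an increase of the interval. -/
theorem IsHamiltonian.det_div_le (hH : IsHamiltonian a b H) {k l : ℝ} (hkl : k ^ 2 + l ^ 2 = 1)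
    (hHt : ∀ t, Ht t = !![k, -l; l, k] * H t * !![k, -l; l, k]ᵀ) (hat : a ≤ t) (htt : t ≤ t')
    (htb : (t' : EReal) < b) (h₂ : 0 < m2 a H t) (h₂' : 0 < m2 a Ht t') :
    0 ≤ (Mmat a Ht t').det / m2 a Ht t' ∧ (Mmat a H t).det / m2 a H t ≤
      (1 + m1 a H t / m2 a H t) * ((Mmat a Ht t').det / m2 a Ht t') := by
  have hHt' := hH.conj (transpose_mul_rotation hkl) hHt
  have htb' : (t : EReal) < b := lt_of_le_of_lt (EReal.coe_le_coe_iff.2 htt) htb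
  obtain ⟨r₁, r₂, r₃⟩ := rotation_primitives hH hat htb' hHt
  have hdet : m1 a Ht t * m2 a Ht t - m3 a Ht t ^ 2 = m1 a H t * m2 a H t - m3 a H t ^ 2 := by
    rw [r₁, r₂, r₃]
    linear_combination (m1 a H t * m2 a H t - m3 a H t ^ 2) * (k ^ 2 + l ^ 2 + 1) * hkl
  have htr : m1 a Ht t + m2 a Ht t = m1 a H t + m2 a H t := by
    rw [r₁, r₂]
    linear_combination (m1 a H t + m2 a H t) * hkl
  have hpos := hHt'.primitive_mono le_rfl hat htb'
  simp only [m1, m2, m3, intervalIntegral.integral_same, mul_zero, add_zero] at hpos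
  change ∀ x y, 0 ≤ x ^ 2 * m1 a Ht t + 2 * x * y * m3 a Ht t + y ^ 2 * m2 a Ht t at hpos
  have p₁ : 0 ≤ m1 a Ht t := by simpa using hpos 1 0
  set c := -(m3 a Ht t' / m2 a Ht t') with hc
  have hE := hHt'.primitive_mono hat htt htb 1 c
  have hE0 := hpos 1 c
  set E := 1 ^ 2 * m1 a Ht t + 2 * 1 * c * m3 a Ht t + c ^ 2 * m2 a Ht t with hEdef
  have e' : 1 ^ 2 * m1 a Ht t' + 2 * 1 * c * m3 a Ht t' + c ^ 2 * m2 a Ht t' =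
      (Mmat a Ht t').det / m2 a Ht t' := by
    simp only [Mmat, Matrix.det_fin_two_of]
    rw [hc]
    field_simp
    ring
  rw [e'] at hE
  refine ⟨hE0.trans hE, ?_⟩
  have hmul : m1 a H t * m2 a H t - m3 a H t ^ 2 ≤ E * m2 a Ht t := by
    rw [← hdet, hEdef]
    nlinarith [sq_nonneg (m3 a Ht t + c * m2 a Ht t)]
  have hfac : 1 + m1 a H t / m2 a H t = (m1 a H t + m2 a H t) / m2 a H t := by
    field_simp; ring
  rw [hfac, div_mul_eq_mul_div]
  gcongr
  have hs : 0 ≤ m1 a H t + m2 a H t := by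
    have := hpos 0 1
    rw [← htr]; linarith
  calc (Mmat a H t).det = m1 a H t * m2 a H t - m3 a H t ^ 2 := by
        simp only [Mmat, Matrix.det_fin_two_of]; ring
    _ ≤ E * m2 a Ht t := hmul
    _ ≤ E * (m1 a H t + m2 a H t) := by gcongr; linarith
    _ = (m1 a H t + m2 a H t) * E := mul_comm _ _
    _ ≤ _ := by gcongr

/-- If `√(m₁ / m₂)` is much smaller after the rotation, the rotated system needs a longer interval
to reach the same value of `m₁ m₂`. -/
theorem IsHamiltonian.le_of_rotation (hH : IsHamiltonian a b H) {k l A At δ : ℝ}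
    (hkl : k ^ 2 + l ^ 2 = 1) (hHt : ∀ t, Ht t = !![k, -l; l, k] * H t * !![k, -l; l, k]ᵀ)
    (hat' : a ≤ t') (htb : (t : EReal) < b) (htb' : (t' : EReal) < b) (hδ : 0 < δ) (hAt : 0 < At)
    (e₁ : m1 a H t = A * δ) (e₂ : m2 a H t = δ / A) (f₁ : m1 a Ht t' = At * δ)
    (f₂ : m2 a Ht t' = δ / At) (h : At * (A + 1 / A) < 1) : t ≤ t' := by
  by_contra! hlt
  have g₁ := hH.primitive_mono hat' hlt.le htb 1 0
  have g₂ := hH.primitive_mono hat' hlt.le htb 0 1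
  obtain ⟨r₁, r₂, -⟩ := rotation_primitives hH hat' htb' hHt
  have htr : m1 a Ht t' + m2 a Ht t' = m1 a H t' + m2 a H t' := by
    rw [r₁, r₂]
    linear_combination (m1 a H t' + m2 a H t') * hkl
  have hle : At * δ + δ / At ≤ (A + 1 / A) * δ := by
    have : (A + 1 / A) * δ = A * δ + δ / A := by ring
    rw [this, ← e₁, ← e₂, ← f₁, ← f₂]
    linarith
  have hle' : δ / At ≤ (A + 1 / A) * δ := by
    have : 0 < At * δ := by positivity
    linarith
  rw [div_le_iff₀ hAt] at hle'
  nlinarith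

theorem IsHamiltonian.normalized_det_le (hH : IsHamiltonian a b H) {k l A At δ c : ℝ}
    (hkl : k ^ 2 + l ^ 2 = 1) (hHt : ∀ t, Ht t = !![k, -l; l, k] * H t * !![k, -l; l, k]ᵀ)
    (hat : a ≤ t) (hat' : a ≤ t') (htb : (t : EReal) < b) (htb' : (t' : EReal) < b) (hδ : 0 < δ)
    (hA : 0 < A) (hAt : 0 < At)
    (e₁ : m1 a H t = A * δ) (e₂ : m2 a H t * A = δ) (f₁ : m1 a Ht t' = At * δ)
    (f₂ : m2 a Ht t' * At = δ) (h : At * (A + 1 / A) < 1) (hc : A ≤ c) :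
    A * (Mmat a H t).det / (m1 a H t * m2 a H t) ≤
      (1 + c ^ 2) * (At * (Mmat a Ht t').det / (m1 a Ht t' * m2 a Ht t')) := by
  rw [← eq_div_iff hA.ne'] at e₂
  rw [← eq_div_iff hAt.ne'] at f₂
  obtain ⟨hnn, hdet⟩ := hH.det_div_le hkl hHt hat
    (hH.le_of_rotation hkl hHt hat' htb htb' hδ hAt e₁ e₂ f₁ f₂ h) htb'
    (by rw [e₂]; positivity) (by rw [f₂]; positivity)
  have g₁ : A * (Mmat a H t).det / (m1 a H t * m2 a H t) =
      (Mmat a H t).det / m2 a H t / δ := by rw [e₁, e₂]; field_simp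
  have g₂ : At * (Mmat a Ht t').det / (m1 a Ht t' * m2 a Ht t') =
      (Mmat a Ht t').det / m2 a Ht t' / δ := by rw [f₁, f₂]; field_simp
  have g₃ : m1 a H t / m2 a H t = A ^ 2 := by rw [e₁, e₂]; field_simp
  rw [g₃] at hdet
  rw [g₁, g₂, ← mul_div_assoc]
  gcongr
  exact hdet.trans (by gcongr)

/-- A Möbius transformation by a rotation that sends the limit point to `0`. -/
theorem moebius_asymptotics {k l : ℝ} (hk : 0 < k) (hkl : k ^ 2 + l ^ 2 = 1) {p pt : ℝ → ℂ}
    (hlim : Tendsto p atTop (𝓝 ((l / k : ℝ) : ℂ)))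
    (hmob : ∀ r, 0 < r → k * p r - l = pt r * (k + l * p r))
    (hpt : ∀ r, 0 < r → 0 ≤ (pt r).im) :
    Tendsto pt atTop (𝓝 0) ∧ ∀ᶠ r in atTop,
      k ^ 2 / 2 * (p r).im ≤ (pt r).im ∧ (pt r).im ≤ 2 * k ^ 2 * (p r).im := by
  have hkC : (k : ℂ) ≠ 0 := by exact_mod_cast hk.ne'
  have hklC : (k : ℂ) ^ 2 + (l : ℂ) ^ 2 = 1 := by exact_mod_cast hkl
  have hden : Tendsto (fun r => (k : ℂ) + l * p r) atTop (𝓝 (1 / k)) := by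
    convert (hlim.const_mul (l : ℂ)).const_add (k : ℂ) using 2
    push_cast
    field_simp
    exact hklC.symm
  have hnum : Tendsto (fun r => (k : ℂ) * p r - l) atTop (𝓝 0) := by
    convert (hlim.const_mul (k : ℂ)).sub_const (l : ℂ) using 2
    push_cast
    field_simp
    simp
  have hden0 : (1 / k : ℂ) ≠ 0 := one_div_ne_zero hkC
  have hnsq : Tendsto (fun r => Complex.normSq (k + l * p r)) atTop (𝓝 (1 / k ^ 2)) := by
    have h := (Complex.continuous_normSq.tendsto _).comp hden
    have e : Complex.normSq (1 / k) = 1 / k ^ 2 := by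
      rw [map_div₀, Complex.normSq_one, Complex.normSq_ofReal, sq]
    rwa [e] at h
  have him : ∀ r, 0 < r → (pt r).im * Complex.normSq (k + l * p r) = (p r).im := by
    intro r hr
    have h := congrArg (fun y => (y * (starRingEnd ℂ) (k + l * p r)).im) (hmob r hr)
    simp only [mul_assoc, Complex.mul_conj] at h
    rw [Complex.im_mul_ofReal] at h
    rw [← h]
    simp
    linear_combination (p r).im * hkl
  refine ⟨?_, ?_⟩
  · have h := hnum.div hden hden0
    rw [zero_div] at h
    refine h.congr' ?_
    filter_upwards [hden.eventually_ne hden0, eventually_gt_atTop 0] with r h₁ h₂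
    simp only [Pi.div_apply]
    rw [hmob r h₂, mul_div_cancel_right₀ _ h₁]
  · have hk2 : 0 < 1 / k ^ 2 := by positivity
    filter_upwards [hnsq.eventually_const_le (half_lt_self hk2),
      hnsq.eventually_le_const (show 1 / k ^ 2 < 2 * (1 / k ^ 2) by linarith),
      eventually_gt_atTop 0] with r h₁ h₂ hr
    have h0 := hpt r hr
    rw [← him r hr]
    constructor
    · calc k ^ 2 / 2 * ((pt r).im * Complex.normSq (k + l * p r))
          ≤ k ^ 2 / 2 * ((pt r).im * (2 * (1 / k ^ 2))) := by gcongr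
        _ = (pt r).im := by field_simp
    · calc (pt r).im = 2 * k ^ 2 * ((pt r).im * (1 / k ^ 2 / 2)) := by field_simp
        _ ≤ _ := by gcongr

end Comparison

/-- Lemma 5.3: the rotation transformation improves the bounds. -/
theorem stmt19 (a : ℝ) (b : EReal) (H : ℝ → Matrix (Fin 2) (Fin 2) ℝ)
    (hH : IsHamiltonian a b H)
    (φ : ℝ) (hφ1 : 0 < φ) (hφ2 : φ < Real.pi) (hφ3 : φ ≠ Real.pi / 2)
    (qH : ℂ → ℂ) (hqH : IsWeylCoefficient a b H qH)
    (hlim : Tendsto (fun r : ℝ => qH ((r : ℂ) * Complex.I)) atTop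
      (nhds ((Real.cos φ / Real.sin φ : ℝ) : ℂ)))
    (Q : Matrix (Fin 2) (Fin 2) ℝ)
    (hQ : Q = !![Real.sin φ, -Real.cos φ; Real.cos φ, Real.sin φ])
    (Ht : ℝ → Matrix (Fin 2) (Fin 2) ℝ) (hHt : ∀ t : ℝ, Ht t = Q * H t * Qᵀ)
    (hdiag : DiagNonVanishing a b H) (hdiagt : DiagNonVanishing a b Ht)
    (qHt : ℂ → ℂ) (hqHt : IsWeylCoefficient a b Ht qHt)
    (q : ℝ) (hq0 : 0 < q) (hq1 : q < 1 - 1 / Real.sqrt 2)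
    (tt tt' : ℝ → ℝ)
    (htt : ∀ r : ℝ, 0 < r → a < tt r ∧ (tt r : EReal) < b ∧
      m1 a H (tt r) * m2 a H (tt r) = q ^ 2 / (4 * r ^ 2))
    (htt' : ∀ r : ℝ, 0 < r → a < tt' r ∧ (tt' r : EReal) < b ∧
      m1 a Ht (tt' r) * m2 a Ht (tt' r) = q ^ 2 / (4 * r ^ 2))
    (A L At Lt : ℝ → ℝ)
    (hA : ∀ r : ℝ, A r = Real.sqrt (m1 a H (tt r) / m2 a H (tt r)))
    (hL : ∀ r : ℝ, L r = A r * (Mmat a H (tt r)).det / (m1 a H (tt r) * m2 a H (tt r)))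
    (hAt : ∀ r : ℝ, At r = Real.sqrt (m1 a Ht (tt' r) / m2 a Ht (tt' r)))
    (hLt : ∀ r : ℝ, Lt r = At r * (Mmat a Ht (tt' r)).det /
      (m1 a Ht (tt' r) * m2 a Ht (tt' r))) :
    (∃ c C : ℝ, 0 < c ∧ 0 < C ∧ ∀ᶠ r : ℝ in atTop,
      c * (qH ((r : ℂ) * Complex.I)).im ≤ (qHt ((r : ℂ) * Complex.I)).im ∧
      (qHt ((r : ℂ) * Complex.I)).im ≤ C * (qH ((r : ℂ) * Complex.I)).im) ∧
    Tendsto (fun r : ℝ => At r / A r) atTop (nhds 0) ∧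
    (∃ C r0 : ℝ, 0 < C ∧ 0 < r0 ∧ ∀ r : ℝ, r0 ≤ r → C * L r ≤ Lt r) := by
  subst hQ
  set k := Real.sin φ
  set l := Real.cos φ
  have hk : 0 < k := Real.sin_pos_of_pos_of_lt_pi hφ1 hφ2
  have hkl : k ^ 2 + l ^ 2 = 1 := Real.sin_sq_add_cos_sq φ
  have hl : l ≠ 0 := by
    intro h0
    refine hφ3 (Real.injOn_cos ⟨hφ1.le, hφ2.le⟩ ⟨by positivity, by linarith [Real.pi_pos]⟩ ?_)
    rw [Real.cos_pi_div_two]; exact h0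
  have hHt' := hH.conj (transpose_mul_rotation hkl) hHt
  obtain ⟨hpt0, him⟩ := moebius_asymptotics hk hkl hlim
    (fun r hr => weylCoefficient_rotation hH hkl hHt hqH hqHt hr)
    (fun r hr => (hqHt.estimate hHt' hr).1)
  have hcomp := fun (r : ℝ) (hr : 0 < r) => hH.sqrt_div_comparable hqH hr hq0 (htt r hr).1.le
    (htt r hr).2.1 (htt r hr).2.2
  have hcompt := fun (r : ℝ) (hr : 0 < r) => hHt'.sqrt_div_comparable hqHt hr hq0 (htt' r hr).1.le
    (htt' r hr).2.1 (htt' r hr).2.2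
  simp only [← hA, ← hAt] at hcomp hcompt
  have hB0 : 0 < 2 + 4 * (1 + q ^ 2) / q := by positivity
  set B := 2 + 4 * (1 + q ^ 2) / q
  have hρ0 : 0 < |l / k| := abs_pos.2 (div_ne_zero hl hk.ne')
  have hnorm := hlim.norm
  rw [Complex.norm_real, Real.norm_eq_abs] at hnorm
  set ρ := |l / k|
  obtain ⟨c₁, c₂, hc₁, hc₂, hAbd⟩ : ∃ c₁ c₂ : ℝ, 0 < c₁ ∧ 0 < c₂ ∧
      ∀ᶠ r in atTop, c₁ ≤ A r ∧ A r ≤ c₂ := by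
    refine ⟨ρ / 2 / B, B * (2 * ρ), by positivity, by positivity, ?_⟩
    filter_upwards [hnorm.eventually_const_le (half_lt_self hρ0),
      hnorm.eventually_le_const (show ρ < 2 * ρ by linarith), eventually_gt_atTop 0]
      with r h₁ h₂ hr
    obtain ⟨-, h₃, h₄⟩ := hcomp r hr
    refine ⟨?_, h₃.trans (by gcongr)⟩
    rw [div_le_iff₀' hB0]
    exact h₁.trans h₄
  have hAt0 : Tendsto At atTop (𝓝 0) := by
    have h := hpt0.norm.const_mul B
    rw [norm_zero, mul_zero] at h
    refine squeeze_zero' ?_ ?_ h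
    · filter_upwards with r
      rw [hAt]; exact Real.sqrt_nonneg _
    · filter_upwards [eventually_gt_atTop 0] with r hr
      exact (hcompt r hr).2.1
  refine ⟨⟨k ^ 2 / 2, 2 * k ^ 2, by positivity, by positivity, him⟩, ?_, ?_⟩
  · have h := hAt0.mul_const (1 / c₁)
    rw [zero_mul] at h
    refine squeeze_zero' ?_ ?_ h
    · filter_upwards [eventually_gt_atTop 0] with r hr
      exact (div_pos (hcompt r hr).1.1 (hcomp r hr).1.1).le
    · filter_upwards [hAbd, eventually_gt_atTop 0] with r h₁ hr
      rw [div_eq_mul_one_div]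
      exact mul_le_mul_of_nonneg_left (one_div_le_one_div_of_le hc₁ h₁.1) (hcompt r hr).1.1.le
  · have hev : ∀ᶠ r in atTop, 1 / (1 + c₂ ^ 2) * L r ≤ Lt r := by
      have hK : 0 < c₂ + 1 / c₁ := by positivity
      filter_upwards [hAbd, eventually_gt_atTop 0,
        hAt0.eventually_lt_const (show 0 < 1 / (c₂ + 1 / c₁) by positivity)] with r hAr hr hAtr
      obtain ⟨⟨a₁, a₂, a₃⟩, -, -⟩ := hcomp r hr
      obtain ⟨⟨b₁, b₂, b₃⟩, -, -⟩ := hcompt r hr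
      obtain ⟨t₁, t₂, -⟩ := htt r hr
      obtain ⟨t₃, t₄, -⟩ := htt' r hr
      have hsmall : At r * (A r + 1 / A r) < 1 := by
        rw [lt_div_iff₀ hK] at hAtr
        refine lt_of_le_of_lt (mul_le_mul_of_nonneg_left (add_le_add hAr.2 ?_) b₁.le) hAtr
        exact one_div_le_one_div_of_le hc₁ hAr.1
      rw [one_div_mul_eq_div, div_le_iff₀' (by positivity), hL, hLt]
      exact hH.normalized_det_le hkl hHt t₁.le t₃.le t₂ t₄ (by positivity) a₁ b₁ a₂ a₃ b₂ b₃
        hsmall hAr.2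
    obtain ⟨r0, hr0⟩ := eventually_atTop.1 hev
    exact ⟨1 / (1 + c₂ ^ 2), max r0 1, by positivity, by positivity,
      fun r hr => hr0 r ((le_max_left _ _).trans hr)⟩

end
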